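/- arXiv:1312.4515 — 3 statements merged into one kernel-verified Lean document; each statement's English description precedes it below -/
import Mathlib

section
/- Assume C is 𝒜-approximating. (a) If 𝒜 has finite C-dimension n, then every object of H_C has projective dimension at most n+2 in H_C; in particular H_C has finite cohomological dimension ≤ n+2. (b) Conversely, if every object of H_C has projective dimension at most d, then every object of 𝒜 has C-dimension at most d. -/
open CategoryTheory Limits

universe v u

variable {A : Type u} [Category.{v} A] [Abelian A]

/-- An object of `K(A)` is bounded above (i.e. lies in `K^-(A)`). -/
def BddAbv (X : HomotopyCategory A (ComplexShape.up ℤ)) : Prop :=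
  ∃ N : ℤ, ∀ i > N, IsZero (X.as.X i)

/-- All terms of the complex lie in the subcategory `𝒞`. -/
def TermsIn (𝒞 : Set A) (X : HomotopyCategory A (ComplexShape.up ℤ)) : Prop :=
  ∀ i : ℤ, X.as.X i ∈ 𝒞

/-- Objects of `T_C = K^-(C)` inside `K(A)`. -/
def InTC (𝒞 : Set A) (X : HomotopyCategory A (ComplexShape.up ℤ)) : Prop :=
  BddAbv X ∧ TermsIn 𝒞 X

/-- Objects of `T≤0_A`. -/
def InTleA (X : HomotopyCategory A (ComplexShape.up ℤ)) : Prop :=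
  BddAbv X ∧ ∀ i > 0, IsZero (X.as.X i)

/-- Objects of `T≤0_C`. -/
def InTleC (𝒞 : Set A) (X : HomotopyCategory A (ComplexShape.up ℤ)) : Prop :=
  InTleA X ∧ TermsIn 𝒞 X

/-- Quasi-isomorphisms in the homotopy category. -/
def IsQIso {X Y : HomotopyCategory A (ComplexShape.up ℤ)} (f : X ⟶ Y) : Prop :=
  ∀ i : ℤ, IsIso ((HomotopyCategory.homologyFunctor A (ComplexShape.up ℤ) i).map f)

/-- `f : Xc ⟶ X` is a `C`-approximation. -/
def IsCApprox (𝒞 : Set A) {Xc X : HomotopyCategory A (ComplexShape.up ℤ)} (f : Xc ⟶ X) : Prop :=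
  InTC 𝒞 Xc ∧ IsQIso f ∧
    ∀ V, InTC 𝒞 V → Function.Bijective (fun g : V ⟶ Xc => g ≫ f)

/-- `C` is `A`-approximating. -/
def CApproximating (𝒞 : Set A) : Prop :=
  ∀ X, BddAbv X → ∃ (Xc : HomotopyCategory A (ComplexShape.up ℤ)) (f : Xc ⟶ X), IsCApprox 𝒞 f

/-- Objects of `T≥0_A = (T≤0_A⟦1⟧)^⊥` in `T_A`. -/
def InTgeA (X : HomotopyCategory A (ComplexShape.up ℤ)) : Prop :=
  BddAbv X ∧ ∀ Y, InTleA Y → ∀ f : Y⟦(1:ℤ)⟧ ⟶ X, f = 0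

/-- Objects of `T≥0_C = (T≤0_C⟦1⟧)^⊥` in `T_C`. -/
def InTgeC (𝒞 : Set A) (X : HomotopyCategory A (ComplexShape.up ℤ)) : Prop :=
  InTC 𝒞 X ∧ ∀ Y, InTleC 𝒞 Y → ∀ f : Y⟦(1:ℤ)⟧ ⟶ X, f = 0

/-- The heart `H_A` of the t-structure on `T_A`. -/
def InHA (X : HomotopyCategory A (ComplexShape.up ℤ)) : Prop :=
  InTleA X ∧ InTgeA X

/-- The heart `H_C` of the t-structure on `T_C`. -/
def InHC (𝒞 : Set A) (X : HomotopyCategory A (ComplexShape.up ℤ)) : Prop :=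
  InTleC 𝒞 X ∧ InTgeC 𝒞 X

/-- `C`-covers. -/
def IsCCover (𝒞 : Set A) {C₀ M : A} (p : C₀ ⟶ M) : Prop :=
  C₀ ∈ 𝒞 ∧ Epi p ∧ ∀ V ∈ 𝒞, ∀ g : V ⟶ M, ∃ h : V ⟶ C₀, h ≫ p = g

/-- A `C`-resolution `⋯ → C¹ → C⁰ → M → 0` of `M`. -/
structure CResolution (𝒞 : Set A) (M : A) where
  obj : ℕ → A
  mem : ∀ n, obj n ∈ 𝒞
  d : ∀ n, obj (n + 1) ⟶ obj n
  ε : obj 0 ⟶ M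
  epi : Epi ε
  w0 : d 0 ≫ ε = 0
  w : ∀ n, d (n + 1) ≫ d n = 0
  exact0 : (ShortComplex.mk (d 0) ε w0).Exact
  exact : ∀ n, (ShortComplex.mk (d (n + 1)) (d n) (w n)).Exact
  homSurj : ∀ V ∈ 𝒞, ∀ g : V ⟶ M, ∃ h : V ⟶ obj 0, h ≫ ε = g
  homExact0 : ∀ V ∈ 𝒞, ∀ g : V ⟶ obj 0, g ≫ ε = 0 → ∃ h : V ⟶ obj 1, h ≫ d 0 = g
  homExact : ∀ n, ∀ V ∈ 𝒞, ∀ g : V ⟶ obj (n + 1),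
    g ≫ d n = 0 → ∃ h : V ⟶ obj (n + 2), h ≫ d (n + 1) = g

/-- `𝒜` has `C`-dimension at most `n`. -/
def CDimLE (𝒞 : Set A) (n : ℕ) : Prop :=
  ∀ M : A, ∃ r : CResolution 𝒞 M, ∀ m > n, IsZero (r.obj m)

/-- `𝒞` is a Karoubi-closed full additive subcategory. -/
structure IsAddKaroubi (𝒞 : Set A) : Prop where
  zero : ∀ Z : A, IsZero Z → Z ∈ 𝒞
  iso : ∀ {X Y : A}, (X ≅ Y) → X ∈ 𝒞 → Y ∈ 𝒞
  biprod : ∀ {X Y : A}, X ∈ 𝒞 → Y ∈ 𝒞 → (X ⊞ Y) ∈ 𝒞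
  summand : ∀ {X Y : A}, X ∈ 𝒞 → ∀ (i : Y ⟶ X) (p : X ⟶ Y), i ≫ p = 𝟙 Y → Y ∈ 𝒞

/-- The object `P_M ∈ H_C` : the complex `M` concentrated in degree `0`. -/
noncomputable def PObj (M : A) : HomotopyCategory A (ComplexShape.up ℤ) :=
  (HomotopyCategory.quotient A (ComplexShape.up ℤ)).obj
    ((HomologicalComplex.single A (ComplexShape.up ℤ) 0).obj M)

/-- The morphism `P_f : P_M ⟶ P_N` induced by `f : M ⟶ N`. -/
noncomputable def PMap {M N : A} (f : M ⟶ N) : PObj M ⟶ PObj N :=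
  (HomotopyCategory.quotient A (ComplexShape.up ℤ)).map
    ((HomologicalComplex.single A (ComplexShape.up ℤ) 0).map f)

section Relative

variable (P : HomotopyCategory A (ComplexShape.up ℤ) → Prop)

/-- Epimorphism relative to the full subcategory `P`. -/
def EpiIn {X Y : HomotopyCategory A (ComplexShape.up ℤ)} (f : X ⟶ Y) : Prop :=
  ∀ Z, P Z → ∀ u v : Y ⟶ Z, f ≫ u = f ≫ v → u = v

/-- Monomorphism relative to the full subcategory `P`. -/
def MonoIn {X Y : HomotopyCategory A (ComplexShape.up ℤ)} (f : X ⟶ Y) : Prop :=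
  ∀ Z, P Z → ∀ u v : Z ⟶ X, u ≫ f = v ≫ f → u = v

/-- Simple object of the full (abelian) subcategory `P`: it is nonzero and every nonzero
morphism into it from an object of `P` is an epimorphism in `P`. -/
def SimpleIn (V : HomotopyCategory A (ComplexShape.up ℤ)) : Prop :=
  P V ∧ ¬ IsZero V ∧ ∀ U, P U → ∀ f : U ⟶ V, f ≠ 0 → EpiIn P f

/-- Projective object of the full subcategory `P`. -/
def ProjectiveIn (Q : HomotopyCategory A (ComplexShape.up ℤ)) : Prop :=
  P Q ∧ ∀ X Y, P X → P Y → ∀ e : X ⟶ Y, EpiIn P e → ∀ g : Q ⟶ Y, ∃ h : Q ⟶ X, h ≫ e = g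

/-- Injective object of the full subcategory `P`. -/
def InjectiveIn (J : HomotopyCategory A (ComplexShape.up ℤ)) : Prop :=
  P J ∧ ∀ X Y, P X → P Y → ∀ m : X ⟶ Y, MonoIn P m → ∀ g : X ⟶ J, ∃ h : Y ⟶ J, m ≫ h = g

/-- `f` is a kernel of `g` relative to the full subcategory `P`. -/
def IsKernelIn {X Y Z : HomotopyCategory A (ComplexShape.up ℤ)} (f : X ⟶ Y) (g : Y ⟶ Z) : Prop :=
  P X ∧ f ≫ g = 0 ∧ ∀ W, P W → ∀ h : W ⟶ Y, h ≫ g = 0 → ∃! l : W ⟶ X, l ≫ f = h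

/-- The sequence `X ⟶ Y ⟶ Z` is exact at `Y` relative to the abelian full subcategory `P`:
the induced map to any kernel of `g` in `P` is an epimorphism in `P`. -/
def ExactIn {X Y Z : HomotopyCategory A (ComplexShape.up ℤ)} (f : X ⟶ Y) (g : Y ⟶ Z) : Prop :=
  f ≫ g = 0 ∧ ∀ (K : HomotopyCategory A (ComplexShape.up ℤ)) (k : K ⟶ Y),
    IsKernelIn P k g → ∀ l : X ⟶ K, l ≫ k = f → EpiIn P l

/-- Short exact sequence `0 ⟶ X ⟶ Y ⟶ Z ⟶ 0` relative to `P`. -/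
def ShortExactIn {X Y Z : HomotopyCategory A (ComplexShape.up ℤ)} (f : X ⟶ Y) (g : Y ⟶ Z) : Prop :=
  MonoIn P f ∧ EpiIn P g ∧ IsKernelIn P f g

end Relative

/-- A projective resolution `⋯ → Q¹ → Q⁰ → V → 0` in the abelian category `H_C`. -/
structure HeartProjRes {A : Type u} [Category.{v} A] [Abelian A] (𝒞 : Set A)
    (V : HomotopyCategory A (ComplexShape.up ℤ)) where
  Q : ℕ → HomotopyCategory A (ComplexShape.up ℤ)
  proj : ∀ n, ProjectiveIn (InHC 𝒞) (Q n)
  d : ∀ n, Q (n + 1) ⟶ Q n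
  ε : Q 0 ⟶ V
  epi : EpiIn (InHC 𝒞) ε
  w0 : d 0 ≫ ε = 0
  w : ∀ n, d (n + 1) ≫ d n = 0
  ex0 : ExactIn (InHC 𝒞) (d 0) ε
  ex : ∀ n, ExactIn (InHC 𝒞) (d (n + 1)) (d n)

/-- `V` has projective dimension `≤ d` in `H_C`. -/
def HeartProjDimLE {A : Type u} [Category.{v} A] [Abelian A] (𝒞 : Set A)
    (V : HomotopyCategory A (ComplexShape.up ℤ)) (d : ℕ) : Prop :=
  ∃ r : HeartProjRes 𝒞 V, ∀ m > d, IsZero (r.Q m)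

namespace HeartDimension

open HomologicalComplex

/-- A choice-free summary of the canonical truncation `τ≤m K ⟶ K`. -/
structure IsTruncLE {K' K : CochainComplex A ℤ} (m : ℤ) (ι : K' ⟶ K) : Prop where
  isZero : ∀ i, m < i → IsZero (K'.X i)
  iso_of_lt : ∀ i, i < m → Nonempty (K'.X i ≅ K.X i)
  iso_cycles : Nonempty (K'.X m ≅ K.cycles m)
  mono : ∀ i, Mono (ι.f i)
  lift : ∀ j, j ≤ m → ∀ {W : A} (a : W ⟶ K.X j), (a ≫ K.d j (j + 1) = 0 ∨ j < m) →
    ∃ b, b ≫ ι.f j = a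

lemma exists_lift_ιTruncLE_of_hom {L K : CochainComplex A ℤ} (m : ℤ)
    (hL : ∀ i, m < i → IsZero (L.X i)) (φ : L ⟶ K) :
    ∃ ψ : L ⟶ K.truncLE m, ψ ≫ K.ιTruncLE m = φ := by
  have : L.IsStrictlyLE m := (L.isStrictlyLE_iff m).2 hL
  exact ⟨inv (L.ιTruncLE m) ≫ CochainComplex.truncLEMap φ m, by simp⟩

lemma isTruncLE_ιTruncLE (K : CochainComplex A ℤ) (m : ℤ) : IsTruncLE m (K.ιTruncLE m) where
  isZero i hi := (K.truncLE m).isZero_of_isStrictlyLE m i hi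
  iso_of_lt i hi := ⟨K.truncLEXIso m i hi⟩
  iso_cycles := ⟨K.truncLEXIsoCycles m⟩
  mono i := inferInstanceAs (Mono ((HomologicalComplex.ιTruncLE K _).f i))
  lift j hj W a ha := by
    by_cases ha' : a ≫ K.d j (j + 1) = 0
    · obtain ⟨ψ, hψ⟩ := exists_lift_ιTruncLE_of_hom (L := (single A (ComplexShape.up ℤ) j).obj W)
        m (fun i hi => isZero_single_obj_X _ _ _ _ (by lia))
        (mkHomFromSingle a (fun k hk => by obtain rfl : j + 1 = k := hk; exact ha'))
      refine ⟨(singleObjXSelf _ j W).inv ≫ ψ.f j, ?_⟩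
      rw [Category.assoc, ← comp_f, hψ]
      simp
    · have hjm : j < m := ha.resolve_left ha'
      have hr : (ComplexShape.up ℤ).Rel j (j + 1) := rfl
      obtain ⟨ψ, hψ⟩ := exists_lift_ιTruncLE_of_hom (L := double (𝟙 W) hr) m
        (fun i hi => isZero_double_X _ _ _ (by lia) (by lia))
        (mkHomFromDouble hr (by lia) a (a ≫ K.d j (j + 1)) (by simp) (by simp))
      refine ⟨(doubleXIso₀ (𝟙 W) hr).inv ≫ ψ.f j, ?_⟩
      rw [Category.assoc, ← comp_f, hψ]
      simp

namespace IsTruncLE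

variable {K' K : CochainComplex A ℤ} {m : ℤ} {ι : K' ⟶ K}

lemma exists_lift (h : IsTruncLE m ι) {L : CochainComplex A ℤ} (φ : L ⟶ K)
    (hφ : ∀ i, m < i → φ.f i = 0) : ∃ ψ : L ⟶ K', ψ ≫ ι = φ := by
  have key : ∀ i, ∃ b : L.X i ⟶ K'.X i, b ≫ ι.f i = φ.f i := by
    intro i
    rcases lt_trichotomy i m with hi | rfl | hi
    · exact h.lift i hi.le _ (Or.inr hi)
    · exact h.lift i le_rfl _ (Or.inl (by rw [φ.comm, hφ _ (by lia), comp_zero]))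
    · exact ⟨0, by rw [hφ i hi, zero_comp]⟩
  choose b hb using key
  refine ⟨⟨b, fun i j _ => ?_⟩, by ext i; exact hb i⟩
  have := h.mono j
  rw [← cancel_mono (ι.f j), Category.assoc, Category.assoc, hb, ← ι.comm, ← Category.assoc, hb,
    φ.comm]

lemma homotopic_zero (h : IsTruncLE m ι) {L : CochainComplex A ℤ}
    (hL : ∀ i, m + 1 < i → IsZero (L.X i)) (ψ : L ⟶ K') (s : Homotopy (ψ ≫ ι) 0) :
    Nonempty (Homotopy ψ 0) := by
  have key : ∀ i j, ∃ b : L.X i ⟶ K'.X j, b ≫ ι.f j = s.hom i j := by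
    intro i j
    by_cases hij : j + 1 = i
    swap
    · exact ⟨0, by rw [zero_comp, s.zero i j hij]⟩
    by_cases hi : m + 1 < i
    · exact ⟨0, (hL i hi).eq_of_src _ _⟩
    refine h.lift j (by lia) _ ?_
    by_cases hj : j < m
    · exact Or.inr hj
    obtain rfl : j = m := by lia
    subst hij
    left
    have e := s.comm (j + 1)
    rw [dNext_eq s.hom (i' := j + 1 + 1) rfl, prevD_eq s.hom (j' := j) rfl] at e
    have hψ : ψ.f (j + 1) = 0 := (h.isZero (j + 1) (by lia)).eq_of_tgt _ _
    have hd : L.d (j + 1) (j + 1 + 1) = 0 := (hL (j + 1 + 1) (by lia)).eq_of_tgt _ _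
    simpa [hψ, hd] using e.symm
  choose b hb using key
  have hmono := h.mono
  have e : ψ = Homotopy.nullHomotopicMap b := by
    have : Mono ι := HomologicalComplex.mono_of_mono_f _ (fun i => h.mono i)
    rw [← cancel_mono ι, Homotopy.nullHomotopicMap_comp]
    ext i
    simpa [Homotopy.nullHomotopicMap, hb] using s.comm i
  rw [e]
  refine ⟨Homotopy.nullHomotopy b fun i j hij => ?_⟩
  rw [← cancel_mono (ι.f j), hb, s.zero i j hij, zero_comp]

lemma eq_zero_of_comp_eq_zero (h : IsTruncLE m ι) {L : HomotopyCategory A (ComplexShape.up ℤ)}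
    (hL : ∀ i, m + 1 < i → IsZero (L.as.X i))
    (ψ : L ⟶ (HomotopyCategory.quotient A (ComplexShape.up ℤ)).obj K')
    (hψ : ψ ≫ (HomotopyCategory.quotient A (ComplexShape.up ℤ)).map ι = 0) : ψ = 0 := by
  obtain ⟨L, rfl⟩ := L.quotient_obj_surjective
  obtain ⟨f, rfl⟩ := (HomotopyCategory.quotient A (ComplexShape.up ℤ)).map_surjective ψ
  rw [← Functor.map_comp, HomotopyCategory.quotient_map_eq_zero_iff] at hψ
  rw [HomotopyCategory.quotient_map_eq_zero_iff]
  exact h.homotopic_zero hL f hψ.some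

lemma exists_comp_eq (h : IsTruncLE m ι) {L : HomotopyCategory A (ComplexShape.up ℤ)}
    (hL : ∀ i, m < i → IsZero (L.as.X i))
    (φ : L ⟶ (HomotopyCategory.quotient A (ComplexShape.up ℤ)).obj K) :
    ∃ ψ, ψ ≫ (HomotopyCategory.quotient A (ComplexShape.up ℤ)).map ι = φ := by
  obtain ⟨L, rfl⟩ := L.quotient_obj_surjective
  obtain ⟨f, rfl⟩ := (HomotopyCategory.quotient A (ComplexShape.up ℤ)).map_surjective φ
  obtain ⟨g, rfl⟩ := h.exists_lift f fun i hi => (hL i hi).eq_of_src _ _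
  exact ⟨(HomotopyCategory.quotient A (ComplexShape.up ℤ)).map g, by rw [Functor.map_comp]⟩

end IsTruncLE

lemma eq_of_comp_eq_of_cancel_zero {D : Type*} [Category* D] [Preadditive D] {X Y Z : D}
    {ι : Y ⟶ Z} (h : ∀ ψ : X ⟶ Y, ψ ≫ ι = 0 → ψ = 0) {a b : X ⟶ Y} (hab : a ≫ ι = b ≫ ι) :
    a = b :=
  sub_eq_zero.1 (h _ (by rw [Preadditive.sub_comp, hab, sub_self]))

lemma isIso_of_section_of_cancel_zero {D : Type*} [Category* D] [Preadditive D] {Y Z : D}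
    {ι : Y ⟶ Z} (h : ∀ ψ : Y ⟶ Y, ψ ≫ ι = 0 → ψ = 0) {s : Z ⟶ Y} (hs : s ≫ ι = 𝟙 Z) :
    IsIso ι :=
  ⟨s, eq_of_comp_eq_of_cancel_zero h (by simp [hs]), hs⟩

lemma isCApprox_comp_of_isIso {𝒞 : Set A} {U' U X : HomotopyCategory A (ComplexShape.up ℤ)}
    {e : U' ⟶ U} (he : IsIso e) {f : U ⟶ X} (hf : IsCApprox 𝒞 f) (hU' : InTC 𝒞 U') :
    IsCApprox 𝒞 (e ≫ f) := by
  refine ⟨hU', fun i => ?_, fun V hV => ⟨fun a b hab => ?_, fun g => ?_⟩⟩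
  · have := hf.2.1 i
    rw [Functor.map_comp]
    infer_instance
  · dsimp only at hab
    rw [← Category.assoc, ← Category.assoc] at hab
    exact (cancel_mono _).1 ((hf.2.2 V hV).1 hab)
  · obtain ⟨g', hg'⟩ := (hf.2.2 V hV).2 g
    exact ⟨g' ≫ inv e, by simpa using hg'⟩

section Cycles

variable {𝒞 : Set A} (h𝒞 : IsAddKaroubi 𝒞) {U : CochainComplex A ℤ} (hU : ∀ i, U.X i ∈ 𝒞)

lemma exists_retraction_of_section {i : ℤ} (s : U.cycles (i + 1) ⟶ U.X i)
    (hs : s ≫ U.d i (i + 1) = U.iCycles (i + 1)) :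
    ∃ r : U.X i ⟶ U.cycles i,
      r ≫ U.iCycles i + U.toCycles i (i + 1) ≫ s = 𝟙 _ ∧ U.iCycles i ≫ r = 𝟙 _ := by
  have hr : (ComplexShape.up ℤ).next i = i + 1 := by simp
  let r : U.X i ⟶ U.cycles i := U.liftCycles (𝟙 _ - U.toCycles i (i + 1) ≫ s) (i + 1) hr (by
    simp [hs])
  have h1 : r ≫ U.iCycles i = 𝟙 _ - U.toCycles i (i + 1) ≫ s := by simp [r]
  refine ⟨r, by rw [h1]; abel, ?_⟩
  have h0 : U.iCycles i ≫ U.toCycles i (i + 1) = 0 := by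
    rw [← cancel_mono (U.iCycles (i + 1))]; simp
  rw [← cancel_mono (U.iCycles i), Category.assoc, h1, Preadditive.comp_sub,
    reassoc_of% h0]
  simp

lemma exists_section_of_cycles_mem {m : ℤ}
    (hvan : ∀ V ∈ 𝒞, ∀ i, m < i → ∀ φ : (single A (ComplexShape.up ℤ) i).obj V ⟶ U,
      Nonempty (Homotopy φ 0)) {i : ℤ} (hi : m ≤ i) (hmem : U.cycles (i + 1) ∈ 𝒞) :
    ∃ s : U.cycles (i + 1) ⟶ U.X i, s ≫ U.d i (i + 1) = U.iCycles (i + 1) := by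
  obtain ⟨h⟩ := hvan _ hmem (i + 1) (by lia) (mkHomFromSingle (U.iCycles (i + 1)) (by simp))
  refine ⟨(singleObjXSelf (ComplexShape.up ℤ) (i + 1) _).inv ≫ h.hom (i + 1) i, ?_⟩
  have e := h.comm (i + 1)
  rw [dNext_eq h.hom (i' := i + 1 + 1) rfl, prevD_eq h.hom (j' := i) rfl] at e
  simp only [mkHomFromSingle_f, single_obj_d, zero_comp, zero_add, zero_f, add_zero] at e
  rw [Category.assoc, ← e]
  simp

include h𝒞 hU

lemma cycles_mem {m N : ℤ} (hN : ∀ i, N < i → IsZero (U.X i))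
    (hvan : ∀ V ∈ 𝒞, ∀ i, m < i → ∀ φ : (single A (ComplexShape.up ℤ) i).obj V ⟶ U,
      Nonempty (Homotopy φ 0)) (i : ℤ) (hi : m ≤ i) : U.cycles i ∈ 𝒞 := by
  obtain ⟨k, hk⟩ : ∃ k : ℕ, N + 1 ≤ i + k := ⟨(N + 1 - i).toNat, by lia⟩
  induction k generalizing i with
  | zero =>
    exact h𝒞.zero _ (IsZero.of_mono (U.iCycles i) (hN i (by lia)))
  | succ k ih =>
    have hm := ih (i + 1) (by lia) (by push_cast at hk; lia)
    obtain ⟨s, hs⟩ := exists_section_of_cycles_mem hvan hi hm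
    obtain ⟨r, -, hr⟩ := exists_retraction_of_section s hs
    exact h𝒞.summand (hU i) _ r hr

lemma isIso_quotient_map_of_isTruncLE {m N : ℤ} (hN : ∀ i, N < i → IsZero (U.X i))
    (hvan : ∀ V ∈ 𝒞, ∀ i, m < i → ∀ φ : (single A (ComplexShape.up ℤ) i).obj V ⟶ U,
      Nonempty (Homotopy φ 0)) {U' : CochainComplex A ℤ} {ι : U' ⟶ U} (hι : IsTruncLE m ι) :
    IsIso ((HomotopyCategory.quotient A (ComplexShape.up ℤ)).map ι) := by
  have hs : ∀ q, m ≤ q → _ := fun q hq => exists_section_of_cycles_mem hvan hq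
    (cycles_mem h𝒞 hU hN hvan _ (by lia))
  choose s hs using hs
  choose r hr hr' using fun q hq => exists_retraction_of_section (s q hq) (hs q hq)
  have hsucc : ∀ {q}, m ≤ q → m ≤ q + 1 := fun h => h.trans (by simp)
  obtain ⟨t, ht⟩ : ∃ t : ∀ q, U.X (q + 1) ⟶ U.X q,
      ∀ q (hq : m ≤ q), t q = r (q + 1) (hsucc hq) ≫ s q hq :=
    ⟨fun q => if hq : m ≤ q then r (q + 1) (hsucc hq) ≫ s q hq else 0, fun q hq => dif_pos hq⟩
  obtain ⟨H, hH, hH'⟩ : ∃ H : ∀ p q, U.X p ⟶ U.X q, (∀ q, H (q + 1) q = t q) ∧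
      ∀ p q, ¬ q + 1 = p → H p q = 0 :=
    ⟨fun p q => if hpq : p = q + 1 then (U.XIsoOfEq hpq).hom ≫ t q else 0,
      fun q => by simp, fun p q h => dif_neg fun h' => h h'.symm⟩
  have hφ : ∀ i, m < i → (𝟙 U - Homotopy.nullHomotopicMap H).f i = 0 := by
    intro i hi
    obtain ⟨k, rfl⟩ : ∃ k, i = k + 1 := ⟨i - 1, (sub_add_cancel i 1).symm⟩
    have hk : m ≤ k := Int.lt_add_one_iff.1 hi
    have e : (Homotopy.nullHomotopicMap H).f (k + 1) = 𝟙 _ := by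
      dsimp only [Homotopy.nullHomotopicMap]
      rw [dNext_eq H (i' := k + 1 + 1) rfl, prevD_eq H (j' := k) rfl, hH, hH,
        ht k hk, ht (k + 1) (hsucc hk), ← U.toCycles_i (k + 1) (k + 1 + 1), Category.assoc,
        Category.assoc, hs, reassoc_of% (hr' (k + 1 + 1) (hsucc (hsucc hk)))]
      exact (add_comm _ _).trans (hr (k + 1) (hsucc hk))
    simp [e]
  obtain ⟨ψ, hψ⟩ := hι.exists_lift _ hφ
  have hnull : (HomotopyCategory.quotient A (ComplexShape.up ℤ)).map
      (Homotopy.nullHomotopicMap H) = 0 := by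
    rw [HomotopyCategory.quotient_map_eq_zero_iff]
    exact ⟨Homotopy.nullHomotopy H hH'⟩
  have e : (HomotopyCategory.quotient A (ComplexShape.up ℤ)).map ψ ≫
      (HomotopyCategory.quotient A (ComplexShape.up ℤ)).map ι = 𝟙 _ := by
    rw [← Functor.map_comp, hψ, Functor.map_sub, hnull, sub_zero, CategoryTheory.Functor.map_id]
  exact isIso_of_section_of_cancel_zero (fun ψ hψ => hι.eq_zero_of_comp_eq_zero
      (fun i hi => hι.isZero i ((lt_add_one m).trans hi)) ψ hψ) e

end Cycles

lemma exists_approx {𝒞 : Set A} (h𝒞 : IsAddKaroubi 𝒞) (happrox : CApproximating 𝒞) {m : ℤ}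
    (X : HomotopyCategory A (ComplexShape.up ℤ)) (hX : ∀ i, m < i → IsZero (X.as.X i)) :
    ∃ (U : HomotopyCategory A (ComplexShape.up ℤ)) (f : U ⟶ X),
      IsCApprox 𝒞 f ∧ ∀ i, m < i → IsZero (U.as.X i) := by
  obtain ⟨X, rfl⟩ := X.quotient_obj_surjective
  obtain ⟨U, f, ⟨⟨N, hN⟩, hU⟩, hq, hbij⟩ := happrox _ ⟨m, hX⟩
  obtain ⟨U, rfl⟩ := U.quotient_obj_surjective
  obtain ⟨f, rfl⟩ := (HomotopyCategory.quotient A (ComplexShape.up ℤ)).map_surjective f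
  have hvan : ∀ V ∈ 𝒞, ∀ i, m < i → ∀ φ : (single A (ComplexShape.up ℤ) i).obj V ⟶ U,
      Nonempty (Homotopy φ 0) := by
    intro V hV i hi φ
    rw [← HomotopyCategory.quotient_map_eq_zero_iff]
    apply (hbij ((HomotopyCategory.quotient A (ComplexShape.up ℤ)).obj
      ((single A (ComplexShape.up ℤ) i).obj V)) ⟨⟨i, fun j hj => isZero_single_obj_X _ _ _ _
        (ne_of_gt hj)⟩, fun j => ?_⟩).1
    · have : φ ≫ f = 0 := by
        apply from_single_hom_ext
        exact (hX i hi).eq_of_tgt _ _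
      dsimp only
      rw [← Functor.map_comp, this, Functor.map_zero, zero_comp]
    · by_cases h : j = i
      · subst h
        exact h𝒞.iso (singleObjXSelf (ComplexShape.up ℤ) j V).symm hV
      · exact h𝒞.zero _ (isZero_single_obj_X _ _ _ _ h)
  have hι := isTruncLE_ιTruncLE U m
  have hiso := isIso_quotient_map_of_isTruncLE h𝒞 hU hN hvan hι
  refine ⟨_, _, isCApprox_comp_of_isIso hiso (hf := ⟨⟨⟨N, hN⟩, hU⟩, hq, hbij⟩)
      ⟨⟨m, hι.isZero⟩, fun i => ?_⟩, hι.isZero⟩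
  rcases lt_trichotomy i m with hi | rfl | hi
  · exact h𝒞.iso (hι.iso_of_lt i hi).some.symm (hU i)
  · exact h𝒞.iso hι.iso_cycles.some.symm (cycles_mem h𝒞 hU hN hvan i le_rfl)
  · exact h𝒞.zero _ (hι.isZero i hi)

lemma shift_as_X (X : HomotopyCategory A (ComplexShape.up ℤ)) (n i : ℤ) :
    (X⟦n⟧).as.X i = X.as.X (i + n) := by
  obtain ⟨X, rfl⟩ := X.quotient_obj_surjective
  rw [HomotopyCategory.shift_quotient_obj]
  rfl

lemma inTgeC_hom_eq_zero {𝒞 : Set A} {S Z : HomotopyCategory A (ComplexShape.up ℤ)}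
    (hS : TermsIn 𝒞 S) (hS' : ∀ i, -1 < i → IsZero (S.as.X i)) (hZ : InTgeC 𝒞 Z)
    (f : S ⟶ Z) : f = 0 := by
  have h1 : InTleC 𝒞 (S⟦(-1 : ℤ)⟧) := by
    have h : ∀ i > 0, IsZero ((S⟦(-1 : ℤ)⟧).as.X i) := fun i hi => by
      rw [shift_as_X]
      exact hS' (i + -1) (by lia)
    exact ⟨⟨⟨0, h⟩, h⟩, fun i => by rw [shift_as_X]; exact hS (i + -1)⟩
  have e : (S⟦(-1 : ℤ)⟧)⟦(1 : ℤ)⟧ ≅ S :=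
    (shiftFunctorCompIsoId (HomotopyCategory A (ComplexShape.up ℤ)) (-1) 1 (by simp)).app S
  rw [← cancel_epi e.hom, hZ.2 _ h1 (e.hom ≫ f), comp_zero]

lemma inTleC_shift {𝒞 : Set A} {Y : HomotopyCategory A (ComplexShape.up ℤ)} (hY : InTleC 𝒞 Y) :
    TermsIn 𝒞 (Y⟦(1 : ℤ)⟧) ∧ ∀ i, -1 < i → IsZero ((Y⟦(1 : ℤ)⟧).as.X i) :=
  ⟨fun i => by rw [shift_as_X]; exact hY.2 (i + 1),
    fun i hi => by rw [shift_as_X]; exact hY.1.2 (i + 1) (by lia)⟩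

open Pretriangulated in
lemma exists_cone {𝒞 : Set A} (h𝒞 : IsAddKaroubi 𝒞)
    {X Y : HomotopyCategory A (ComplexShape.up ℤ)} (f : X ⟶ Y)
    (hX : InTleC 𝒞 X) (hY : InTleC 𝒞 Y) :
    ∃ (W : HomotopyCategory A (ComplexShape.up ℤ)) (g : Y ⟶ W) (h : W ⟶ X⟦(1 : ℤ)⟧),
      Triangle.mk f g h ∈ distTriang _ ∧ InTleC 𝒞 W := by
  obtain ⟨X, rfl⟩ := X.quotient_obj_surjective
  obtain ⟨Y, rfl⟩ := Y.quotient_obj_surjective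
  obtain ⟨f, rfl⟩ := (HomotopyCategory.quotient A (ComplexShape.up ℤ)).map_surjective f
  refine ⟨_, _, _, HomotopyCategory.mappingCone_triangleh_distinguished f, ?_⟩
  have e : ∀ i, (CochainComplex.mappingCone f).X i ≅ X.X (i + 1) ⊞ Y.X i := fun i =>
    homotopyCofiber.XIsoBiprod f i (i + 1) (by simp)
  have h : ∀ i > 0, IsZero ((CochainComplex.mappingCone f).X i) := fun i hi =>
    IsZero.of_iso ((biprod_isZero_iff _ _).2 ⟨hX.1.2 (i + 1) (by lia), hY.1.2 i hi⟩) (e i)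
  exact ⟨⟨⟨0, h⟩, h⟩, fun i => h𝒞.iso (e i).symm (h𝒞.biprod (hX.2 (i + 1)) (hY.2 i))⟩

open Pretriangulated in
lemma exists_heart_quotient {𝒞 : Set A} (h𝒞 : IsAddKaroubi 𝒞) (happrox : CApproximating 𝒞)
    (T : HomotopyCategory A (ComplexShape.up ℤ)) (hT : InTleC 𝒞 T) :
    ∃ (U W : HomotopyCategory A (ComplexShape.up ℤ)) (g : U ⟶ T) (p : T ⟶ W),
      InHC 𝒞 W ∧ (TermsIn 𝒞 U ∧ ∀ i, -1 < i → IsZero (U.as.X i)) ∧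
      ∀ (V : HomotopyCategory A (ComplexShape.up ℤ)) (f : V ⟶ T), f ≫ p = 0 →
        ∃ f', f' ≫ g = f := by
  obtain ⟨T, rfl⟩ := T.quotient_obj_surjective
  obtain ⟨T', t, hι⟩ : ∃ (T' : CochainComplex A ℤ) (t : T' ⟶ T), IsTruncLE (-1) t :=
    ⟨_, _, isTruncLE_ιTruncLE T (-1)⟩
  obtain ⟨U, α, hα, hU⟩ := exists_approx h𝒞 happrox (m := -1)
    ((HomotopyCategory.quotient A (ComplexShape.up ℤ)).obj T') hι.isZero
  have hUC : InTleC 𝒞 U := ⟨⟨⟨-1, hU⟩, fun i hi => hU i (by lia)⟩, hα.1.2⟩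
  let ι := (HomotopyCategory.quotient A (ComplexShape.up ℤ)).map t
  obtain ⟨W, p, q, hW, hWC⟩ := exists_cone h𝒞 (α ≫ ι) hUC hT
  refine ⟨U, W, α ≫ ι, p, ⟨hWC, ⟨hWC.1.1, hWC.2⟩, fun Y hY φ => ?_⟩, ⟨hα.1.2, hU⟩,
    fun V f hf => ?_⟩
  · have hq : φ ≫ q = 0 := by
      obtain ⟨ψ, hψ⟩ := (shiftFunctor (HomotopyCategory A (ComplexShape.up ℤ))
        (1 : ℤ)).map_surjective (φ ≫ q)
      have h0 : q ≫ (α ≫ ι)⟦(1 : ℤ)⟧' = 0 := comp_distTriang_mor_zero₃₁ _ hW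
      have h1 : (ψ ≫ α) ≫ ι = 0 := by
        apply (shiftFunctor (HomotopyCategory A (ComplexShape.up ℤ)) (1 : ℤ)).map_injective
        rw [Category.assoc, Functor.map_comp, hψ, Category.assoc, h0, comp_zero, Functor.map_zero]
      have h2 : ψ ≫ α = 0 :=
        hι.eq_zero_of_comp_eq_zero (fun i hi => hY.1.2 i (by lia)) _ h1
      have h3 : ψ = 0 := (hα.2.2 Y ⟨hY.1.1, hY.2⟩).1 (by simpa using h2)
      rw [← hψ, h3, Functor.map_zero]
    obtain ⟨φ', hφ'⟩ : ∃ φ', φ = φ' ≫ p := Triangle.coyoneda_exact₃ _ hW φ hq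
    obtain ⟨hY1, hY2⟩ := inTleC_shift hY
    obtain ⟨χ, hχ⟩ := hι.exists_comp_eq hY2 φ'
    obtain ⟨ω, hω⟩ := (hα.2.2 _ ⟨⟨-1, hY2⟩, hY1⟩).2 χ
    have h4 : (α ≫ ι) ≫ p = 0 := comp_distTriang_mor_zero₁₂ _ hW
    dsimp only at hω
    rw [hφ', ← hχ, ← hω, Category.assoc ω]
    exact (Category.assoc _ _ _).trans ((congrArg (ω ≫ ·) h4).trans comp_zero)
  · obtain ⟨f', hf'⟩ := Triangle.coyoneda_exact₂ _ hW f hf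
    exact ⟨f', hf'.symm⟩


lemma quotient_hom_eq_zero {X Y : HomotopyCategory A (ComplexShape.up ℤ)}
    (h : ∀ i, IsZero (X.as.X i) ∨ IsZero (Y.as.X i)) (f : X ⟶ Y) : f = 0 := by
  obtain ⟨X, rfl⟩ := X.quotient_obj_surjective
  obtain ⟨Y, rfl⟩ := Y.quotient_obj_surjective
  obtain ⟨f, rfl⟩ := (HomotopyCategory.quotient A (ComplexShape.up ℤ)).map_surjective f
  have : f = 0 := by
    ext i
    obtain h | h := h i
    · exact IsZero.eq_of_src h _ _
    · exact IsZero.eq_of_tgt h _ _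
  rw [this, Functor.map_zero]

lemma isZero_PObj_X (M : A) (i : ℤ) (hi : i ≠ 0) : IsZero ((PObj M).as.X i) :=
  isZero_single_obj_X _ _ _ _ hi

lemma inTleA_PObj (M : A) : InTleA (PObj M) :=
  ⟨⟨0, fun i hi => isZero_PObj_X M i (by lia)⟩, fun i hi => isZero_PObj_X M i (by lia)⟩

lemma inTleC_PObj {𝒞 : Set A} (h𝒞 : IsAddKaroubi 𝒞) {V : A} (hV : V ∈ 𝒞) :
    InTleC 𝒞 (PObj V) := by
  refine ⟨inTleA_PObj V, fun i => ?_⟩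
  by_cases hi : i = 0
  · subst hi
    exact h𝒞.iso (singleObjXSelf (ComplexShape.up ℤ) 0 V).symm hV
  · exact h𝒞.zero _ (isZero_PObj_X V i hi)

lemma to_PObj_eq_zero {S : HomotopyCategory A (ComplexShape.up ℤ)} {M : A}
    (hS : ∀ i, -1 < i → IsZero (S.as.X i)) (f : S ⟶ PObj M) : f = 0 :=
  quotient_hom_eq_zero (fun i => by
    by_cases hi : i = 0
    · exact Or.inl (hS i (by lia))
    · exact Or.inr (isZero_PObj_X M i hi)) f

lemma from_PObj_eq_zero {S : HomotopyCategory A (ComplexShape.up ℤ)} {M : A}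
    (hS : ∀ i, -1 < i → IsZero (S.as.X i)) (f : PObj M ⟶ S) : f = 0 :=
  quotient_hom_eq_zero (fun i => by
    by_cases hi : i = 0
    · exact Or.inr (hS i (by lia))
    · exact Or.inl (isZero_PObj_X M i hi)) f

lemma inHC_PObj {𝒞 : Set A} (h𝒞 : IsAddKaroubi 𝒞) {V : A} (hV : V ∈ 𝒞) :
    InHC 𝒞 (PObj V) :=
  ⟨inTleC_PObj h𝒞 hV, ⟨(inTleC_PObj h𝒞 hV).1.1, (inTleC_PObj h𝒞 hV).2⟩, fun _ hY f =>
    to_PObj_eq_zero (inTleC_shift hY).2 f⟩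

open Pretriangulated in
lemma exists_lift_of_epiIn {𝒞 : Set A} (h𝒞 : IsAddKaroubi 𝒞) (happrox : CApproximating 𝒞)
    {X Y : HomotopyCategory A (ComplexShape.up ℤ)} (hX : InHC 𝒞 X) (hY : InHC 𝒞 Y)
    (e : X ⟶ Y) (he : EpiIn (InHC 𝒞) e) {M : A} (f : PObj M ⟶ Y) :
    ∃ f', f' ≫ e = f := by
  obtain ⟨T, g, h, hT, hTC⟩ := exists_cone h𝒞 e hX.1 hY.1
  obtain ⟨U, W, u, p, hW, hU, hp⟩ := exists_heart_quotient h𝒞 happrox T hTC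
  have heg : e ≫ g = 0 := comp_distTriang_mor_zero₁₂ _ hT
  have h0 : g ≫ p = 0 := he W hW _ _ (by rw [reassoc_of% heg, zero_comp, comp_zero])
  obtain ⟨g', hg'⟩ := hp _ g h0
  obtain ⟨f', hf'⟩ := Triangle.coyoneda_exact₂ _ hT f (by
    change f ≫ g = 0
    rw [← hg', ← Category.assoc, from_PObj_eq_zero hU.2 (f ≫ g'), zero_comp])
  exact ⟨f', hf'.symm⟩

lemma projectiveIn_PObj {𝒞 : Set A} (h𝒞 : IsAddKaroubi 𝒞) (happrox : CApproximating 𝒞)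
    {V : A} (hV : V ∈ 𝒞) : ProjectiveIn (InHC 𝒞) (PObj V) :=
  ⟨inHC_PObj h𝒞 hV, fun _ _ hX hY e he g => exists_lift_of_epiIn h𝒞 happrox hX hY e he g⟩


lemma PMap_comp {L M N : A} (f : L ⟶ M) (g : M ⟶ N) : PMap (f ≫ g) = PMap f ≫ PMap g := by
  simp only [PMap, Functor.map_comp]
  rfl

lemma PMap_id (M : A) : PMap (𝟙 M) = 𝟙 (PObj M) := by
  simp only [PMap, CategoryTheory.Functor.map_id]
  rfl

lemma PMap_zero (M N : A) : PMap (0 : M ⟶ N) = 0 := by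
  simp only [PMap, Functor.map_zero]
  rfl

lemma quotient_map_toSingle_injective {K : CochainComplex A ℤ} (hK : ∀ i > 0, IsZero (K.X i))
    {N : A} {f g : K ⟶ (single A (ComplexShape.up ℤ) 0).obj N}
    (h : (HomotopyCategory.quotient A (ComplexShape.up ℤ)).map f =
      (HomotopyCategory.quotient A (ComplexShape.up ℤ)).map g) : f = g := by
  have H := HomotopyCategory.homotopyOfEq _ _ h
  apply to_single_hom_ext
  have e := H.comm 0
  rw [dNext_eq H.hom (i' := 1) (by simp), prevD_eq H.hom (j' := -1) (by simp),
    (hK 1 (by simp)).eq_of_src (H.hom 1 0) 0] at e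
  simpa using e

lemma PMap_injective {M N : A} {f g : M ⟶ N} (h : PMap f = PMap g) : f = g :=
  (single A (ComplexShape.up ℤ) 0).map_injective
    (quotient_map_toSingle_injective (fun i hi => isZero_single_obj_X _ _ _ _ (by lia)) h)

lemma PMap_surjective {M N : A} (f : PObj M ⟶ PObj N) : ∃ g : M ⟶ N, PMap g = f := by
  obtain ⟨f, rfl⟩ := (HomotopyCategory.quotient A (ComplexShape.up ℤ)).map_surjective f
  obtain ⟨g, rfl⟩ := (single A (ComplexShape.up ℤ) 0).map_surjective f
  exact ⟨g, rfl⟩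

section FromTerm

variable {K : CochainComplex A ℤ} (hK : ∀ i > 0, IsZero (K.X i))

/-- The morphism from an object in degree `0` to a complex in nonpositive degrees that is given
by a morphism to the term of degree `0`. -/
noncomputable def fromTerm {M : A} (φ : M ⟶ K.X 0) :
    PObj M ⟶ (HomotopyCategory.quotient A (ComplexShape.up ℤ)).obj K :=
  (HomotopyCategory.quotient A (ComplexShape.up ℤ)).map
    (mkHomFromSingle φ fun i hi => (hK i (by
      obtain rfl : 0 + 1 = i := hi
      simp)).eq_of_tgt _ _)

lemma fromTerm_surjective {M : A}
    (f : PObj M ⟶ (HomotopyCategory.quotient A (ComplexShape.up ℤ)).obj K) :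
    ∃ φ : M ⟶ K.X 0, fromTerm hK φ = f := by
  obtain ⟨f, rfl⟩ := (HomotopyCategory.quotient A (ComplexShape.up ℤ)).map_surjective f
  refine ⟨(singleObjXSelf (ComplexShape.up ℤ) 0 M).inv ≫ f.f 0, ?_⟩
  refine congrArg (HomotopyCategory.quotient A (ComplexShape.up ℤ)).map ?_
  apply from_single_hom_ext
  simp

lemma PMap_comp_fromTerm {L M : A} (χ : L ⟶ M) (φ : M ⟶ K.X 0) :
    PMap χ ≫ fromTerm hK φ = fromTerm hK (χ ≫ φ) := by
  refine ((HomotopyCategory.quotient A (ComplexShape.up ℤ)).map_comp _ _).symm.trans ?_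
  refine congrArg (HomotopyCategory.quotient A (ComplexShape.up ℤ)).map ?_
  apply from_single_hom_ext
  simp [single_map_f_self]

lemma fromTerm_eq_zero_iff {M : A} (φ : M ⟶ K.X 0) :
    fromTerm hK φ = 0 ↔ ∃ ψ : M ⟶ K.X (-1), ψ ≫ K.d (-1) 0 = φ := by
  refine (HomotopyCategory.quotient_map_eq_zero_iff _).trans ⟨fun ⟨H⟩ => ?_, fun ⟨ψ, hψ⟩ => ⟨?_⟩⟩
  · have e := H.comm 0
    rw [dNext_eq H.hom (i' := 1) (by simp), prevD_eq H.hom (j' := -1) (by simp)] at e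
    refine ⟨(singleObjXSelf (ComplexShape.up ℤ) 0 M).inv ≫ H.hom 0 (-1), ?_⟩
    rw [← cancel_epi (singleObjXSelf (ComplexShape.up ℤ) 0 M).hom]
    simpa using e.symm
  · let h : ∀ p q, ((single A (ComplexShape.up ℤ) 0).obj M).X p ⟶ K.X q := fun p q =>
      if hpq : p = 0 ∧ q = -1 then
        (XIsoOfEq _ hpq.1).hom ≫ (singleObjXSelf (ComplexShape.up ℤ) 0 M).hom ≫ ψ ≫
          (XIsoOfEq _ hpq.2).inv else 0
    refine (Homotopy.ofEq ?_).trans (Homotopy.nullHomotopy h fun p q hpq => dif_neg ?_)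
    · apply from_single_hom_ext
      dsimp only [Homotopy.nullHomotopicMap]
      rw [dNext_eq h (i' := 1) (by simp), prevD_eq h (j' := -1) (by simp)]
      simp [h, hψ]
    · rintro ⟨rfl, rfl⟩
      simp at hpq

lemma eq_zero_of_fromTerm_comp_eq_zero {𝒞 : Set A} (h𝒞 : IsAddKaroubi 𝒞)
    (happrox : CApproximating 𝒞) (hKC : ∀ i, K.X i ∈ 𝒞)
    {Z : HomotopyCategory A (ComplexShape.up ℤ)} (hZ : InTgeC 𝒞 Z)
    (u : (HomotopyCategory.quotient A (ComplexShape.up ℤ)).obj K ⟶ Z)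
    (hu : fromTerm hK (𝟙 _) ≫ u = 0) : u = 0 := by
  obtain ⟨Z, rfl⟩ := Z.quotient_obj_surjective
  obtain ⟨u, rfl⟩ := (HomotopyCategory.quotient A (ComplexShape.up ℤ)).map_surjective u
  replace hu := ((HomotopyCategory.quotient A (ComplexShape.up ℤ)).map_comp _ _).trans hu
  obtain ⟨H⟩ := (HomotopyCategory.quotient_map_eq_zero_iff _).1 hu
  obtain ⟨ψ, hψ⟩ : ∃ ψ : K.X 0 ⟶ Z.X (-1), ψ ≫ Z.d (-1) 0 = u.f 0 := by
    have e := H.comm 0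
    rw [dNext_eq H.hom (i' := 1) (by simp), prevD_eq H.hom (j' := -1) (by simp)] at e
    refine ⟨(singleObjXSelf (ComplexShape.up ℤ) 0 _).inv ≫ H.hom 0 (-1), ?_⟩
    rw [← cancel_epi (singleObjXSelf (ComplexShape.up ℤ) 0 _).hom]
    simpa using e.symm
  let h : ∀ p q, K.X p ⟶ Z.X q := fun p q =>
    if hpq : p = 0 ∧ q = -1 then (XIsoOfEq _ hpq.1).hom ≫ ψ ≫ (XIsoOfEq _ hpq.2).inv else 0
  have hh : ∀ p q, ¬ (ComplexShape.up ℤ).Rel q p → h p q = 0 := fun p q hpq => dif_neg (by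
    rintro ⟨rfl, rfl⟩
    simp at hpq)
  have hnull : (HomotopyCategory.quotient A (ComplexShape.up ℤ)).map
      (Homotopy.nullHomotopicMap h) = 0 :=
    (HomotopyCategory.quotient_map_eq_zero_iff _).2 ⟨Homotopy.nullHomotopy h hh⟩
  obtain ⟨T', t, ht⟩ : ∃ (T' : CochainComplex A ℤ) (t : T' ⟶ Z), IsTruncLE (-1) t :=
    ⟨_, _, isTruncLE_ιTruncLE Z (-1)⟩
  obtain ⟨w, hw⟩ := ht.exists_lift (u - Homotopy.nullHomotopicMap h) (fun i hi => by
    by_cases h0 : i = 0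
    · subst h0
      rw [sub_f_apply]
      dsimp only [Homotopy.nullHomotopicMap]
      rw [dNext_eq h (i' := 1) (by simp), prevD_eq h (j' := -1) (by simp)]
      simp [h, hψ]
    · exact (hK i (by lia)).eq_of_src _ _)
  obtain ⟨U, α, hα, hU⟩ := exists_approx h𝒞 happrox (m := -1)
    ((HomotopyCategory.quotient A (ComplexShape.up ℤ)).obj T') ht.isZero
  obtain ⟨w', hw'⟩ := (hα.2.2 ((HomotopyCategory.quotient A (ComplexShape.up ℤ)).obj K)
    ⟨⟨0, hK⟩, hKC⟩).2 ((HomotopyCategory.quotient A (ComplexShape.up ℤ)).map w)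
  dsimp only at hw'
  have e1 : (HomotopyCategory.quotient A (ComplexShape.up ℤ)).map u =
      (HomotopyCategory.quotient A (ComplexShape.up ℤ)).map
        (u - Homotopy.nullHomotopicMap h) := by
    rw [Functor.map_sub, hnull, sub_zero]
  rw [e1, ← hw, Functor.map_comp, ← hw', Category.assoc,
    inTgeC_hom_eq_zero hα.1.2 hU hZ (α ≫ _), comp_zero]

end FromTerm

lemma epiIn_of_exists_lift {𝒞 : Set A} (h𝒞 : IsAddKaroubi 𝒞) (happrox : CApproximating 𝒞)
    {X Y : HomotopyCategory A (ComplexShape.up ℤ)} (hY : InTleC 𝒞 Y) (f : X ⟶ Y)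
    (h : ∀ V ∈ 𝒞, ∀ g : PObj V ⟶ Y, ∃ g', g' ≫ f = g) : EpiIn (InHC 𝒞) f := by
  intro Z hZ u v huv
  obtain ⟨Y, rfl⟩ := Y.quotient_obj_surjective
  have hY0 : ∀ i > 0, IsZero (Y.X i) := hY.1.2
  have hYC : ∀ i, Y.X i ∈ 𝒞 := hY.2
  obtain ⟨g, hg⟩ := h _ (hYC 0) (fromTerm hY0 (𝟙 _))
  rw [← sub_eq_zero]
  apply eq_zero_of_fromTerm_comp_eq_zero hY0 h𝒞 happrox hY.2 hZ.2
  rw [← hg, Category.assoc, Preadditive.comp_sub, huv, sub_self, comp_zero]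

lemma exactIn_of_exists_lift {𝒞 : Set A} (h𝒞 : IsAddKaroubi 𝒞) (happrox : CApproximating 𝒞)
    {X Y Z : HomotopyCategory A (ComplexShape.up ℤ)} (f : X ⟶ Y) (g : Y ⟶ Z) (w : f ≫ g = 0)
    (h : ∀ V ∈ 𝒞, ∀ y : PObj V ⟶ Y, y ≫ g = 0 → ∃ x, x ≫ f = y) :
    ExactIn (InHC 𝒞) f g := by
  refine ⟨w, fun K k hk l hl => epiIn_of_exists_lift h𝒞 happrox hk.1.1 _ fun V hV y => ?_⟩
  obtain ⟨x, hx⟩ := h V hV (y ≫ k) (by rw [Category.assoc, hk.2.1, comp_zero])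
  refine ⟨x, (hk.2.2 _ (inHC_PObj h𝒞 hV) (y ≫ k) ?_).unique ?_ rfl⟩
  · rw [Category.assoc, hk.2.1, comp_zero]
  · rw [Category.assoc, hl, hx]

lemma exactIn_PMap {𝒞 : Set A} (h𝒞 : IsAddKaroubi 𝒞) (happrox : CApproximating 𝒞)
    {L M N : A} (f : L ⟶ M) (g : M ⟶ N) (w : f ≫ g = 0)
    (h : ∀ V ∈ 𝒞, ∀ y : V ⟶ M, y ≫ g = 0 → ∃ x, x ≫ f = y) :
    ExactIn (InHC 𝒞) (PMap f) (PMap g) := by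
  refine exactIn_of_exists_lift h𝒞 happrox _ _ (by rw [← PMap_comp, w, PMap_zero])
    fun V hV y hy => ?_
  obtain ⟨y, rfl⟩ := PMap_surjective y
  obtain ⟨x, hx⟩ := h V hV y (PMap_injective (by rw [PMap_comp, hy, PMap_zero]))
  exact ⟨PMap x, by rw [← PMap_comp, hx]⟩

lemma isZero_PObj_iff (M : A) : IsZero (PObj M) ↔ IsZero M := by
  rw [IsZero.iff_id_eq_zero, IsZero.iff_id_eq_zero, ← PMap_id, ← PMap_zero]
  exact ⟨fun h => PMap_injective h, fun h => by rw [h]⟩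

lemma heartProjDimLE_of_cDimLE {𝒞 : Set A} (h𝒞 : IsAddKaroubi 𝒞) (happrox : CApproximating 𝒞)
    {n : ℕ} (hn : CDimLE 𝒞 n) (V : HomotopyCategory A (ComplexShape.up ℤ)) (hV : InHC 𝒞 V) :
    HeartProjDimLE 𝒞 V (n + 2) := by
  obtain ⟨K, rfl⟩ := V.quotient_obj_surjective
  have hK : ∀ i > 0, IsZero (K.X i) := hV.1.1.2
  have hKC : ∀ i, K.X i ∈ 𝒞 := hV.1.2
  obtain ⟨r, hr⟩ := hn (kernel (K.d (-1) 0))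
  let N : ℕ → A
    | 0 => K.X 0
    | 1 => K.X (-1)
    | m + 2 => r.obj m
  let d : ∀ m, N (m + 1) ⟶ N m
    | 0 => K.d (-1) 0
    | 1 => r.ε ≫ kernel.ι _
    | m + 2 => r.d m
  have hN : ∀ m, N m ∈ 𝒞
    | 0 => hKC 0
    | 1 => hKC (-1)
    | m + 2 => r.mem m
  have hd : ∀ m, d (m + 1) ≫ d m = 0
    | 0 => by simp [d]
    | 1 => by
      have := r.w0
      simp [d, reassoc_of% this]
    | m + 2 => r.w m
  have hex : ∀ m, ∀ V ∈ 𝒞, ∀ y : V ⟶ N (m + 1), y ≫ d m = 0 → ∃ x, x ≫ d (m + 1) = y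
    | 0 => fun V hV y hy => by
      obtain ⟨x, hx⟩ := r.homSurj V hV (kernel.lift _ y hy)
      exact ⟨x, by rw [← kernel.lift_ι _ y hy, ← hx, Category.assoc]⟩
    | 1 => fun V hV y hy => by
      refine r.homExact0 V hV y ?_
      rw [← cancel_mono (kernel.ι _), Category.assoc, zero_comp]
      exact hy
    | m + 2 => fun V hV y hy => r.homExact m V hV y hy
  have w0 : PMap (d 0) ≫ fromTerm hK (𝟙 _) = 0 := by
    rw [PMap_comp_fromTerm, fromTerm_eq_zero_iff]
    exact ⟨𝟙 _, by simp [d]⟩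
  refine ⟨⟨fun m => PObj (N m), fun m => projectiveIn_PObj h𝒞 happrox (hN m), fun m => PMap (d m),
    fromTerm hK (𝟙 _), ?_, w0, fun m => ?_, ?_, fun m => ?_⟩, fun m hm => ?_⟩
  · refine epiIn_of_exists_lift h𝒞 happrox hV.1 _ fun V hV g => ?_
    obtain ⟨g, rfl⟩ := fromTerm_surjective hK g
    exact ⟨PMap g, by rw [PMap_comp_fromTerm, Category.comp_id]⟩
  · rw [← PMap_comp, hd, PMap_zero]
  · refine exactIn_of_exists_lift h𝒞 happrox _ _ w0 fun V hV y hy => ?_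
    obtain ⟨y, rfl⟩ := PMap_surjective y
    rw [PMap_comp_fromTerm, fromTerm_eq_zero_iff] at hy
    obtain ⟨ψ, hψ⟩ := hy
    exact ⟨PMap ψ, by rw [← PMap_comp]; exact congrArg PMap (hψ.trans (Category.comp_id _))⟩
  · exact exactIn_PMap h𝒞 happrox _ _ (hd m) (hex m)
  · obtain ⟨k, rfl⟩ : ∃ k, m = k + 2 := ⟨m - 2, by lia⟩
    exact (isZero_PObj_iff _).2 (hr k (by lia))

lemma exists_iso_PObj_of_projectiveIn {𝒞 : Set A} (h𝒞 : IsAddKaroubi 𝒞)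
    (happrox : CApproximating 𝒞) {Q : HomotopyCategory A (ComplexShape.up ℤ)}
    (hQ : ProjectiveIn (InHC 𝒞) Q) : ∃ N ∈ 𝒞, Nonempty (Q ≅ PObj N) := by
  obtain ⟨K, rfl⟩ := Q.quotient_obj_surjective
  have hK : ∀ i > 0, IsZero (K.X i) := hQ.1.1.1.2
  have hKC : ∀ i, K.X i ∈ 𝒞 := hQ.1.1.2
  obtain ⟨s, hs⟩ := hQ.2 _ _ (inHC_PObj h𝒞 (hKC 0)) hQ.1 (fromTerm hK (𝟙 _))
    (epiIn_of_exists_lift h𝒞 happrox hQ.1.1 _ fun V hV g => by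
      obtain ⟨g, rfl⟩ := fromTerm_surjective hK g
      exact ⟨PMap g, by rw [PMap_comp_fromTerm, Category.comp_id]⟩) (𝟙 _)
  obtain ⟨e, he⟩ := PMap_surjective (fromTerm hK (𝟙 _) ≫ s)
  obtain ⟨I, i, p, hip, hpi⟩ := IsIdempotentComplete.idempotents_split (K.X 0) e
    (PMap_injective (by rw [PMap_comp, he, Category.assoc, reassoc_of% hs]))
  refine ⟨I, h𝒞.summand (hKC 0) i p hip, ⟨⟨s ≫ PMap p, PMap i ≫ fromTerm hK (𝟙 _), ?_, ?_⟩⟩⟩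
  · rw [Category.assoc, ← Category.assoc (PMap p), ← PMap_comp, hpi, he, Category.assoc, hs,
      Category.comp_id, hs]
  · rw [Category.assoc, ← Category.assoc _ s, ← he, ← PMap_comp, ← PMap_comp, ← hpi,
      Category.assoc, hip, Category.comp_id, hip, PMap_id]

lemma exists_comp_PMap_kernel_ι {W : HomotopyCategory A (ComplexShape.up ℤ)}
    (hW : ∀ i > 0, IsZero (W.as.X i)) {N L : A} (φ : N ⟶ L) (w : W ⟶ PObj N)
    (hw : w ≫ PMap φ = 0) : ∃ w', w' ≫ PMap (kernel.ι φ) = w := by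
  obtain ⟨K, rfl⟩ := W.quotient_obj_surjective
  obtain ⟨w, rfl⟩ := (HomotopyCategory.quotient A (ComplexShape.up ℤ)).map_surjective w
  replace hw := ((HomotopyCategory.quotient A (ComplexShape.up ℤ)).map_comp _ _).trans hw
  have e : w ≫ (single A (ComplexShape.up ℤ) 0).map φ = 0 :=
    quotient_map_toSingle_injective hW (hw.trans (Functor.map_zero _ _ _).symm)
  have e0 : (w.f 0 ≫ (singleObjXSelf (ComplexShape.up ℤ) 0 N).hom) ≫ φ = 0 := by
    have := congr_hom e 0
    rw [comp_f, single_map_f_self] at this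
    rw [← cancel_mono (singleObjXSelf (ComplexShape.up ℤ) 0 L).inv]
    simpa using this
  refine ⟨(HomotopyCategory.quotient A (ComplexShape.up ℤ)).map
    (mkHomToSingle (kernel.lift φ _ e0) fun i hi => ?_), ?_⟩
  · rw [← cancel_mono (kernel.ι φ)]
    have := w.comm i 0
    rw [single_obj_d, comp_zero] at this
    simp [← reassoc_of% this]
  · refine ((HomotopyCategory.quotient A (ComplexShape.up ℤ)).map_comp _ _).symm.trans ?_
    refine congrArg (HomotopyCategory.quotient A (ComplexShape.up ℤ)).map ?_
    apply to_single_hom_ext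
    simp [single_map_f_self]

lemma PMap_cancel_mono {W : HomotopyCategory A (ComplexShape.up ℤ)}
    (hW : ∀ i > 0, IsZero (W.as.X i)) {M N : A} (φ : M ⟶ N) [Mono φ] {a b : W ⟶ PObj M}
    (hab : a ≫ PMap φ = b ≫ PMap φ) : a = b := by
  obtain ⟨K, rfl⟩ := W.quotient_obj_surjective
  obtain ⟨a, rfl⟩ := (HomotopyCategory.quotient A (ComplexShape.up ℤ)).map_surjective a
  obtain ⟨b, rfl⟩ := (HomotopyCategory.quotient A (ComplexShape.up ℤ)).map_surjective b
  have e : a ≫ (single A (ComplexShape.up ℤ) 0).map φ =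
      b ≫ (single A (ComplexShape.up ℤ) 0).map φ :=
    quotient_map_toSingle_injective hW
      (((HomotopyCategory.quotient A (ComplexShape.up ℤ)).map_comp _ _).trans
        (hab.trans ((HomotopyCategory.quotient A (ComplexShape.up ℤ)).map_comp _ _).symm))
  refine congrArg (HomotopyCategory.quotient A (ComplexShape.up ℤ)).map ?_
  apply to_single_hom_ext
  rw [← cancel_mono ((singleObjXSelf (ComplexShape.up ℤ) 0 M).hom),
    ← cancel_mono φ, ← cancel_mono (singleObjXSelf (ComplexShape.up ℤ) 0 N).inv]
  have := congr_hom e 0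
  rw [comp_f, comp_f, single_map_f_self] at this
  simpa using this

lemma exists_heart_approx {𝒞 : Set A} (h𝒞 : IsAddKaroubi 𝒞) (happrox : CApproximating 𝒞)
    (M : A) : ∃ (R : HomotopyCategory A (ComplexShape.up ℤ)) (ρ : R ⟶ PObj M),
      IsCApprox 𝒞 ρ ∧ InHC 𝒞 R := by
  obtain ⟨R, ρ, hρ, hR⟩ := exists_approx h𝒞 happrox (m := 0) (PObj M) (inTleA_PObj M).2
  refine ⟨R, ρ, hρ, ⟨⟨hρ.1.1, hR⟩, hρ.1.2⟩, hρ.1, fun Y hY f => ?_⟩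
  obtain ⟨hY1, hY2⟩ := inTleC_shift hY
  refine (hρ.2.2 _ ⟨⟨-1, hY2⟩, hY1⟩).1 ?_
  dsimp only
  rw [to_PObj_eq_zero hY2 (f ≫ ρ), zero_comp]

lemma exists_lift_of_exactIn {𝒞 : Set A} (h𝒞 : IsAddKaroubi 𝒞) (happrox : CApproximating 𝒞)
    {X Y Z : HomotopyCategory A (ComplexShape.up ℤ)} (hX : InHC 𝒞 X) {f : X ⟶ Y} {g : Y ⟶ Z}
    (hfg : ExactIn (InHC 𝒞) f g) {N L : A} (α : Y ≅ PObj N) (j : Z ⟶ PObj L)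
    (hj : ∀ W, InHC 𝒞 W → ∀ w : W ⟶ Z, w ≫ j = 0 → w = 0)
    {V : A} (hV : V ∈ 𝒞) (y : PObj V ⟶ Y) (hy : y ≫ g = 0) : ∃ x, x ≫ f = y := by
  obtain ⟨φ, hφ⟩ := PMap_surjective (α.inv ≫ g ≫ j)
  obtain ⟨R, ρ, hρ, hR⟩ := exists_heart_approx h𝒞 happrox (kernel φ)
  have hk : IsKernelIn (InHC 𝒞) (ρ ≫ PMap (kernel.ι φ) ≫ α.inv) g := by
    refine ⟨hR, hj R hR _ ?_, fun W hW w hw => ?_⟩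
    · simp only [Category.assoc]
      rw [← hφ, ← PMap_comp, kernel.condition, PMap_zero, comp_zero]
    · obtain ⟨w', hw'⟩ := exists_comp_PMap_kernel_ι hW.1.1.2 φ (w ≫ α.hom) (by
        rw [hφ, Category.assoc, Iso.hom_inv_id_assoc, reassoc_of% hw, zero_comp])
      obtain ⟨l, hl⟩ := (hρ.2.2 W hW.2.1).2 w'
      dsimp only at hl
      refine ⟨l, ?_, fun l' hl' => (hρ.2.2 W hW.2.1).1 ?_⟩
      · dsimp only
        rw [reassoc_of% hl, reassoc_of% hw', Iso.hom_inv_id, Category.comp_id]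
      · dsimp only at hl' ⊢
        rw [hl]
        refine PMap_cancel_mono hW.1.1.2 (kernel.ι φ) ?_
        rw [hw', ← hl']
        simp
  obtain ⟨l, hl, -⟩ := hk.2.2 X hX f hfg.1
  obtain ⟨z, hz, -⟩ := hk.2.2 _ (inHC_PObj h𝒞 hV) y hy
  obtain ⟨x, hx⟩ := exists_lift_of_epiIn h𝒞 happrox hX hR l (hfg.2 _ _ hk l hl) z
  exact ⟨x, by rw [← hl, reassoc_of% hx, hz]⟩

lemma exists_epi_of_mem {𝒞 : Set A} (h𝒞 : IsAddKaroubi 𝒞) (happrox : CApproximating 𝒞)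
    (M : A) : ∃ (V : A) (π : V ⟶ M), V ∈ 𝒞 ∧ Epi π := by
  obtain ⟨R, ρ, hρ, hR⟩ := exists_heart_approx h𝒞 happrox M
  obtain ⟨K, rfl⟩ := R.quotient_obj_surjective
  obtain ⟨r, rfl⟩ := (HomotopyCategory.quotient A (ComplexShape.up ℤ)).map_surjective ρ
  have h1 : IsIso (homologyMap r 0) := by
    have h := hρ.2.1 0
    exact ((NatIso.isIso_map_iff
      (HomotopyCategory.homologyFunctorFactors A (ComplexShape.up ℤ) 0) r).1 h)
  have h2 : IsIso (((single A (ComplexShape.up ℤ) 0).obj M).homologyπ 0) :=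
    isIso_homologyπ _ (-1) 0 (by simp) (by simp)
  have h3 : Epi (cyclesMap r 0) := by
    have : Epi (cyclesMap r 0 ≫ ((single A (ComplexShape.up ℤ) 0).obj M).homologyπ 0) := by
      rw [← homologyπ_naturality]
      infer_instance
    exact (MorphismProperty.epimorphisms A).of_postcomp _ _ h2 this
  have h4 : IsIso (((single A (ComplexShape.up ℤ) 0).obj M).iCycles 0) :=
    isIso_iCycles _ 0 1 (by simp) (by simp)
  have h5 : Epi (K.iCycles 0 ≫ r.f 0) := by
    rw [← cyclesMap_i]
    infer_instance
  have h6 : Epi (r.f 0) := epi_of_epi (K.iCycles 0) _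
  exact ⟨K.X 0, r.f 0 ≫ (singleObjXSelf (ComplexShape.up ℤ) 0 M).hom, hR.1.2 0,
    inferInstance⟩

lemma exact_of_exists_lift {𝒞 : Set A} (h𝒞 : IsAddKaroubi 𝒞) (happrox : CApproximating 𝒞)
    (S : ShortComplex A)
    (h : ∀ V ∈ 𝒞, ∀ y : V ⟶ S.X₂, y ≫ S.g = 0 → ∃ x, x ≫ S.f = y) : S.Exact := by
  obtain ⟨V, π, hV, hπ⟩ := exists_epi_of_mem h𝒞 happrox (kernel S.g)
  obtain ⟨x, hx⟩ := h V hV (π ≫ kernel.ι _) (by simp)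
  rw [ShortComplex.exact_iff_epi_kernel_lift]
  refine epi_of_epi_fac (f := x) (h := π) ?_
  rw [← cancel_mono (kernel.ι S.g)]
  simpa using hx

lemma cDimLE_of_heartProjDimLE {𝒞 : Set A} (h𝒞 : IsAddKaroubi 𝒞) (happrox : CApproximating 𝒞)
    {d : ℕ} (hd : ∀ V, InHC 𝒞 V → HeartProjDimLE 𝒞 V d) : CDimLE 𝒞 d := by
  intro M
  obtain ⟨R, ρ, hρ, hR⟩ := exists_heart_approx h𝒞 happrox M
  obtain ⟨r, hr⟩ := hd R hR
  choose N hN α using fun n => exists_iso_PObj_of_projectiveIn h𝒞 happrox (r.proj n)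
  replace α := fun n => (α n).some
  choose dN hdN using fun n => PMap_surjective ((α (n + 1)).inv ≫ r.d n ≫ (α n).hom)
  obtain ⟨ε, hε⟩ := PMap_surjective ((α 0).inv ≫ r.ε ≫ ρ)
  have hsurj : ∀ V ∈ 𝒞, ∀ g : V ⟶ M, ∃ h, h ≫ ε = g := fun V hV g => by
    obtain ⟨a, ha⟩ := (hρ.2.2 _ (inHC_PObj h𝒞 hV).2.1).2 (PMap g)
    obtain ⟨b, hb⟩ := exists_lift_of_epiIn h𝒞 happrox (r.proj 0).1 hR r.ε r.epi a
    obtain ⟨c, hc⟩ := PMap_surjective (b ≫ (α 0).hom)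
    dsimp only at ha
    refine ⟨c, PMap_injective ?_⟩
    rw [PMap_comp, hc, hε]
    simp [reassoc_of% hb, ha]
  have hex0 : ∀ V ∈ 𝒞, ∀ g : V ⟶ N 0, g ≫ ε = 0 → ∃ h, h ≫ dN 0 = g := fun V hV g hg => by
    obtain ⟨b, hb⟩ := exists_lift_of_exactIn h𝒞 happrox (r.proj 1).1 r.ex0 (α 0) ρ
      (fun W hW w hw => (hρ.2.2 W hW.2.1).1 (by simpa using hw)) hV (PMap g ≫ (α 0).inv)
      ((hρ.2.2 _ (inHC_PObj h𝒞 hV).2.1).1 (by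
        dsimp only
        rw [Category.assoc, Category.assoc, ← hε, ← PMap_comp, hg, PMap_zero, zero_comp]))
    obtain ⟨c, hc⟩ := PMap_surjective (b ≫ (α 1).hom)
    refine ⟨c, PMap_injective ?_⟩
    rw [PMap_comp, hc, hdN]
    simp [reassoc_of% hb]
  have hex : ∀ n, ∀ V ∈ 𝒞, ∀ g : V ⟶ N (n + 1), g ≫ dN n = 0 → ∃ h, h ≫ dN (n + 1) = g :=
    fun n V hV g hg => by
    obtain ⟨b, hb⟩ := exists_lift_of_exactIn h𝒞 happrox (r.proj (n + 2)).1 (r.ex n) (α (n + 1))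
      (α n).hom (fun W hW w hw => by rwa [← cancel_mono (α n).hom, zero_comp]) hV
      (PMap g ≫ (α (n + 1)).inv) (by
        rw [← cancel_mono (α n).hom, Category.assoc, Category.assoc, ← hdN, ← PMap_comp, hg,
          PMap_zero, zero_comp])
    obtain ⟨c, hc⟩ := PMap_surjective (b ≫ (α (n + 2)).hom)
    refine ⟨c, PMap_injective ?_⟩
    rw [PMap_comp, hc, hdN]
    simp [reassoc_of% hb]
  have w0 : dN 0 ≫ ε = 0 := PMap_injective (by
    have := r.w0
    rw [PMap_comp, hdN, hε, PMap_zero]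
    simp [reassoc_of% this])
  have w : ∀ n, dN (n + 1) ≫ dN n = 0 := fun n => PMap_injective (by
    have := r.w n
    rw [PMap_comp, hdN, hdN, PMap_zero]
    simp [reassoc_of% this])
  have hepi : Epi ε := by
    obtain ⟨V, π, hV, hπ⟩ := exists_epi_of_mem h𝒞 happrox M
    obtain ⟨x, hx⟩ := hsurj V hV π
    exact epi_of_epi_fac hx
  exact ⟨⟨N, hN, dN, ε, hepi, w0, w, exact_of_exists_lift h𝒞 happrox _ hex0,
    fun n => exact_of_exists_lift h𝒞 happrox _ (hex n), hsurj, hex0, hex⟩,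
    fun m hm => (isZero_PObj_iff _).1 ((hr m hm).of_iso (α m).symm)⟩

end HeartDimension

/-!
STATEMENT 8: Assume `C` is `A`-approximating.
(a) If `A` has finite `C`-dimension `n`, then every object of `H_C` has projective dimension
    at most `n + 2` in `H_C` (so `H_C` has finite cohomological dimension `≤ n + 2`).
(b) Conversely, if every object of `H_C` has projective dimension at most `d`, then every
    object of `A` has `C`-dimension at most `d`.
-/
theorem statement8 {A : Type u} [Category.{v} A] [Abelian A]
    (𝒞 : Set A) (h𝒞 : IsAddKaroubi 𝒞) (happrox : CApproximating 𝒞) :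
    (∀ n : ℕ, CDimLE 𝒞 n → ∀ V, InHC 𝒞 V → HeartProjDimLE 𝒞 V (n + 2))
    ∧ (∀ d : ℕ, (∀ V, InHC 𝒞 V → HeartProjDimLE 𝒞 V d) → CDimLE 𝒞 d) := by
  exact ⟨fun _ hn V hV => HeartDimension.heartProjDimLE_of_cDimLE h𝒞 happrox hn V hV,
    fun _ hd => HeartDimension.cDimLE_of_heartProjDimLE h𝒞 happrox hd⟩
end

section
/- Assume C is 𝒜-approximating. Let V = [X → Y → Z] be a simple object of H_𝒜. Then the C-approximation π_C V is either zero or a simple object of H_C; and if moreover Z ∈ C, then π_C V is nonzero (hence simple). -/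
open CategoryTheory Limits

universe v u

variable {A : Type u} [Category.{v} A] [Abelian A]

/-- Essential (isomorphism-closed) membership in the heart `H_A`. -/
def EssInHA {A : Type u} [Category.{v} A] [Abelian A]
    (X : HomotopyCategory A (ComplexShape.up ℤ)) : Prop :=
  ∃ W, InHA W ∧ Nonempty (W ≅ X)

/-- Essential (isomorphism-closed) membership in the heart `H_C`. -/
def EssInHC {A : Type u} [Category.{v} A] [Abelian A] (𝒞 : Set A)
    (X : HomotopyCategory A (ComplexShape.up ℤ)) : Prop :=
  ∃ W, InHC 𝒞 W ∧ Nonempty (W ≅ X)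

namespace HomotopyHeart

local notation "K(" A ")" => HomotopyCategory A (ComplexShape.up ℤ)

/-- All terms of the complex in degrees `> n` vanish. -/
def TermsLE (n : ℤ) (X : K(A)) : Prop := ∀ i > n, IsZero (X.as.X i)

/-- The quotient functor from cochain complexes to the homotopy category. -/
noncomputable abbrev Qh : CochainComplex A ℤ ⥤ K(A) :=
  HomotopyCategory.quotient A (ComplexShape.up ℤ)

lemma exists_unshift (X : K(A)) :
    ∃ Y : K(A), (∀ i, Y.as.X i = X.as.X (i - 1)) ∧ Nonempty (Y⟦(1 : ℤ)⟧ ≅ X) := by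
  refine ⟨Qh.obj ((X.as : CochainComplex A ℤ)⟦(-1 : ℤ)⟧), fun i => rfl, ⟨?_⟩⟩
  exact ((Qh.commShiftIso (-1 : ℤ)).app _ |> (shiftFunctor _ (1 : ℤ)).mapIso) ≪≫
    (shiftFunctorCompIsoId _ (-1 : ℤ) 1 (by simp)).app (Qh.obj X.as)

lemma exists_shift (X : K(A)) :
    ∃ Y : K(A), (∀ i, Y.as.X i = X.as.X (i + 1)) ∧ Nonempty (X⟦(1 : ℤ)⟧ ≅ Y) :=
  ⟨Qh.obj ((X.as : CochainComplex A ℤ)⟦(1 : ℤ)⟧), fun _ => rfl,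
    ⟨((Qh.commShiftIso (1 : ℤ)).app _).symm⟩⟩

lemma _root_.InTgeA.eq_zero {X W : K(A)} (hW : InTgeA W) (hX : TermsLE (-1) X) (f : X ⟶ W) : f = 0 := by
  obtain ⟨Y, hY, ⟨e⟩⟩ := exists_unshift X
  have hY0 : ∀ i > 0, IsZero (Y.as.X i) := fun i hi => by
    rw [hY]; exact hX _ (by lia)
  have := hW.2 Y ⟨⟨0, hY0⟩, hY0⟩ (e.hom ≫ f)
  rwa [Preadditive.IsIso.comp_left_eq_zero] at this

lemma _root_.InTgeC.eq_zero {𝒞 : Set A} {X W : K(A)} (hW : InTgeC 𝒞 W) (hX : TermsLE (-1) X)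
    (hX' : TermsIn 𝒞 X) (f : X ⟶ W) : f = 0 := by
  obtain ⟨Y, hY, ⟨e⟩⟩ := exists_unshift X
  have hY0 : ∀ i > 0, IsZero (Y.as.X i) := fun i hi => by
    rw [hY]; exact hX _ (by lia)
  have := hW.2 Y ⟨⟨⟨0, hY0⟩, hY0⟩, fun i => by rw [hY]; exact hX' _⟩ (e.hom ≫ f)
  rwa [Preadditive.IsIso.comp_left_eq_zero] at this

open CochainComplex.HomComplex in
/-- If the last differential `Xᵐ ⟶ Xᵐ⁺¹` of a complex is a split epimorphism, then the complex is
homotopy equivalent to a degreewise direct summand of it which vanishes in degrees `> m`. -/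
lemma exists_iso_termsLE_of_section (X : CochainComplex A ℤ) (m n : ℤ) (hmn : m + 1 = n)
    (hX : ∀ i > n, IsZero (X.X i)) (s : X.X n ⟶ X.X m) (hs : s ≫ X.d m n = 𝟙 _) :
    ∃ W : K(A), Nonempty (W ≅ Qh.obj X) ∧ TermsLE m W ∧
      ∀ i, ∃ (a : W.as.X i ⟶ X.X i) (b : X.X i ⟶ W.as.X i), a ≫ b = 𝟙 _ := by
  let hom : ∀ i j, X.X i ⟶ X.X j := fun i j =>
    if h : i + (-1) = j then (Cochain.single s (-1) : Cochain X X (-1)).v i j h else 0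
  have hom_self : hom n m = s := by
    dsimp only [hom]
    rw [dif_pos (by lia), Cochain.single_v]
  have hom_zero : ∀ i j, i ≠ n → hom i j = 0 := fun i j hi => by
    dsimp only [hom]
    split_ifs
    · rw [Cochain.single_v_eq_zero _ _ _ _ _ hi]
    · rfl
  have hom_rel : ∀ i j, ¬ (ComplexShape.up ℤ).Rel j i → hom i j = 0 := fun i j hij =>
    dif_neg fun h => hij (add_neg_eq_iff_eq_add.1 h).symm
  clear_value hom
  let ν := Homotopy.nullHomotopicMap hom
  have hν : ∀ i, ν.f i = X.d i (i + 1) ≫ hom (i + 1) i + hom i (i - 1) ≫ X.d (i - 1) i :=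
    fun i => Homotopy.nullHomotopicMap_f (by simp) (by simp) hom
  obtain rfl : m = n - 1 := by lia
  have hν_self : ν.f n = 𝟙 _ := by
    rw [hν, hom_self, hs, hom_zero (n + 1) n (by lia), comp_zero, zero_add]
  have hν_pred : ν.f (n - 1) = X.d (n - 1) n ≫ s := by
    rw [hν, hom_zero (n - 1) _ (by lia), zero_comp, add_zero]
    have : ∀ k, k = n → X.d (n - 1) k ≫ hom k (n - 1) = X.d (n - 1) n ≫ s := by
      rintro k rfl; rw [hom_self]
    exact this _ (by lia)
  have hν_zero : ∀ i, i ≠ n → i ≠ n - 1 → ν.f i = 0 := fun i hi hi' => by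
    rw [hν, hom_zero i _ hi, hom_zero (i + 1) _ (by lia)]; simp
  have hidem : ν ≫ ν = ν := by
    ext i
    rw [HomologicalComplex.comp_f]
    by_cases hi : i = n
    · subst hi; rw [hν_self, Category.id_comp]
    by_cases hi' : i = n - 1
    · subst hi'; rw [hν_pred, Category.assoc, reassoc_of% hs]
    · rw [hν_zero i hi hi', zero_comp]
  obtain ⟨W, a, b, hab, hba⟩ := IsIdempotentComplete.idempotents_split X (𝟙 X - ν)
    (Idempotents.idem_of_id_sub_idem ν hidem)
  have hQν : Qh.map ν = 0 := by
    rw [HomotopyCategory.quotient_map_eq_zero_iff]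
    exact ⟨Homotopy.nullHomotopy hom hom_rel⟩
  refine ⟨Qh.obj W, ⟨⟨Qh.map a, Qh.map b, ?_, ?_⟩⟩, fun i hi => ?_, fun i => ⟨a.f i, b.f i, ?_⟩⟩
  · rw [← Functor.map_comp, hab, CategoryTheory.Functor.map_id]
  · rw [← Functor.map_comp, hba, Functor.map_sub, hQν, sub_zero, CategoryTheory.Functor.map_id]
  · have hz : (𝟙 X - ν).f i = 0 := by
      by_cases h : i = n
      · subst h; simp [hν_self]
      · exact (hX i (by lia)).eq_of_src _ _
    have h1 : a.f i ≫ b.f i = 𝟙 _ := by rw [← HomologicalComplex.comp_f, hab]; rfl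
    have h2 : b.f i ≫ a.f i = 0 := by rw [← HomologicalComplex.comp_f, hba, hz]
    rw [IsZero.iff_id_eq_zero]
    change 𝟙 (W.X i) = 0
    rw [← h1, ← Category.comp_id (b.f i), ← h1, reassoc_of% h2]; simp
  · exact (HomologicalComplex.comp_f a b i).symm.trans (by rw [hab]; rfl)

/-- If `Xⁱ` vanishes for `i > n` and the inclusion `Xⁿ[-n] ⟶ X` is null-homotopic, then `X` is
homotopy equivalent to a degreewise direct summand which vanishes in degrees `≥ n`. -/
lemma exists_iso_termsLE_pred (X : K(A)) (n : ℤ) (hX : TermsLE n X)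
    (h : ∀ f : Qh.obj ((HomologicalComplex.single A (ComplexShape.up ℤ) n).obj (X.as.X n)) ⟶ X,
      f = 0) :
    ∃ W : K(A), Nonempty (W ≅ X) ∧ TermsLE (n - 1) W ∧
      ∀ i, ∃ (a : W.as.X i ⟶ X.as.X i) (b : X.as.X i ⟶ W.as.X i), a ≫ b = 𝟙 _ := by
  let j : (HomologicalComplex.single A (ComplexShape.up ℤ) n).obj (X.as.X n) ⟶ X.as :=
    HomologicalComplex.mkHomFromSingle (𝟙 _) fun k hk => (hX k (by
      simp only [ComplexShape.up_Rel] at hk; lia)).eq_of_tgt _ _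
  obtain ⟨H⟩ := (HomotopyCategory.quotient_map_eq_zero_iff j).1 (h (Qh.map j))
  have hc := H.comm n
  rw [dNext_eq _ (show (ComplexShape.up ℤ).Rel n (n + 1) by simp),
    prevD_eq _ (show (ComplexShape.up ℤ).Rel (n - 1) n by simp),
    HomologicalComplex.mkHomFromSingle_f] at hc
  simp only [HomologicalComplex.single_obj_d, zero_comp, zero_add, HomologicalComplex.zero_f,
    add_zero, Category.comp_id] at hc
  exact exists_iso_termsLE_of_section X.as (n - 1) n (by lia) hX
    ((HomologicalComplex.singleObjXSelf (ComplexShape.up ℤ) n (X.as.X n)).inv ≫ H.hom n (n - 1))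
    (by rw [Category.assoc, ← hc, Iso.inv_hom_id])

lemma inTC_single {𝒞 : Set A} (h𝒞 : IsAddKaroubi 𝒞) {M : A} (hM : M ∈ 𝒞) (n : ℤ) :
    InTC 𝒞 (Qh.obj ((HomologicalComplex.single A (ComplexShape.up ℤ) n).obj M)) := by
  refine ⟨⟨n, fun i hi => HomologicalComplex.isZero_single_obj_X _ _ _ _ (by lia)⟩, fun i => ?_⟩
  by_cases hi : i = n
  · subst hi
    exact h𝒞.iso (HomologicalComplex.singleObjXSelf (ComplexShape.up ℤ) i M).symm hM
  · exact h𝒞.zero _ (HomologicalComplex.isZero_single_obj_X _ _ _ _ hi)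

lemma exists_iso_termsLE {𝒞 : Set A} (h𝒞 : IsAddKaroubi 𝒞) (n : ℤ) (X : K(A)) (hX : InTC 𝒞 X)
    (h : ∀ i > n, ∀ M ∈ 𝒞,
      ∀ f : Qh.obj ((HomologicalComplex.single A (ComplexShape.up ℤ) i).obj M) ⟶ X, f = 0) :
    ∃ W : K(A), Nonempty (W ≅ X) ∧ TermsLE n W ∧ TermsIn 𝒞 W := by
  obtain ⟨⟨N, hN⟩, hX⟩ := hX
  have key : ∀ (k : ℕ) (X : K(A)), TermsIn 𝒞 X → TermsLE (n + k) X → (∀ i > n, ∀ M ∈ 𝒞,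
      ∀ f : Qh.obj ((HomologicalComplex.single A (ComplexShape.up ℤ) i).obj M) ⟶ X, f = 0) →
      ∃ W : K(A), Nonempty (W ≅ X) ∧ TermsLE n W ∧ TermsIn 𝒞 W := by
    intro k
    induction k with
    | zero => exact fun X hX hX' _ => ⟨X, ⟨Iso.refl _⟩, by simpa using hX', hX⟩
    | succ k ih =>
      intro X hX hX' h
      obtain ⟨Y, ⟨e⟩, hY, hY'⟩ := exists_iso_termsLE_pred X _ hX'
        (h _ (by push_cast; lia) _ (hX _))
      obtain ⟨W, ⟨e'⟩, hW⟩ := ih Y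
        (fun i => by obtain ⟨a, b, hab⟩ := hY' i; exact h𝒞.summand (hX i) a b hab)
        (fun i hi => hY i (by push_cast; lia))
        (fun i hi M hM f => by
          have := h i hi M hM (f ≫ e.hom)
          rwa [Preadditive.IsIso.comp_right_eq_zero] at this)
      exact ⟨W, ⟨e' ≪≫ e⟩, hW⟩
  exact key (N - n).toNat X hX (fun i hi => hN i (by lia)) h

lemma _root_.IsCApprox.exists_iso_termsLE {𝒞 : Set A} (h𝒞 : IsAddKaroubi 𝒞) {n : ℤ} {Xc X : K(A)}
    {f : Xc ⟶ X} (hf : IsCApprox 𝒞 f) (hX : TermsLE n X) :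
    ∃ W : K(A), Nonempty (W ≅ Xc) ∧ TermsLE n W ∧ TermsIn 𝒞 W := by
  refine HomotopyHeart.exists_iso_termsLE h𝒞 n Xc hf.1 fun i hi M hM g => ?_
  refine (hf.2.2 _ (inTC_single h𝒞 hM i)).1 ?_
  obtain ⟨φ, hφ⟩ := Qh.map_surjective (X := (HomologicalComplex.single A (ComplexShape.up ℤ) i).obj M)
    (Y := X.as) (g ≫ f)
  have : φ = 0 := HomologicalComplex.from_single_hom_ext ((hX i hi).eq_of_tgt _ _)
  have hgf : g ≫ f = 0 := hφ.symm.trans (by rw [this, Functor.map_zero]; rfl)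
  simpa using hgf

section Truncation

variable (X : CochainComplex A ℤ)

/-- The morphism whose kernel is the degree `i` term of the canonical truncation `τ≤-1 X`. -/
noncomputable def truncMap (i : ℤ) : X.X i ⟶ X.X i ⊞ X.X (i + 1) :=
  biprod.lift (if 0 ≤ i then 𝟙 _ else 0) (if -1 ≤ i then X.d i (i + 1) else 0)

variable {X} in
lemma comp_truncMap_eq_zero {T : A} {i : ℤ} (a : T ⟶ X.X i) (h₀ : 0 ≤ i → a = 0)
    (h₁ : -1 ≤ i → a ≫ X.d i (i + 1) = 0) : a ≫ truncMap X i = 0 := by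
  ext
  · by_cases h : 0 ≤ i
    · simp [h₀ h]
    · simp [truncMap, h]
  · by_cases h : -1 ≤ i
    · simp [truncMap, h, h₁ h]
    · simp [truncMap, h]

lemma kernel_ι_truncMap_d (i j : ℤ) (hi : -1 ≤ i) :
    kernel.ι (truncMap X i) ≫ X.d i j = 0 := by
  by_cases hij : i + 1 = j
  · subst hij
    have h := kernel.condition (truncMap X i) =≫ biprod.snd
    rw [zero_comp] at h
    simpa [truncMap, hi] using h
  · rw [X.shape _ _ hij, comp_zero]

/-- The canonical truncation `τ≤-1 X`. -/
noncomputable def trunc : CochainComplex A ℤ where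
  X i := kernel (truncMap X i)
  d i j := kernel.lift _ (kernel.ι _ ≫ X.d i j) (comp_truncMap_eq_zero _
    (fun hj => by
      by_cases hij : i + 1 = j
      · exact kernel_ι_truncMap_d X i j (by lia)
      · rw [X.shape _ _ hij, comp_zero])
    (fun _ => by simp))
  shape i j hij := by
    rw [← cancel_mono (kernel.ι _)]
    simp [X.shape _ _ hij]
  d_comp_d' i j k _ _ := by
    rw [← cancel_mono (kernel.ι _)]
    simp

/-- The inclusion of the canonical truncation. -/
noncomputable def truncι : trunc X ⟶ X where
  f i := kernel.ι (truncMap X i)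
  comm' i j _ := by simp [trunc]

instance (i : ℤ) : Mono ((truncι X).f i) :=
  inferInstanceAs (Mono (kernel.ι (truncMap X i)))

variable {X} in
lemma exists_lift_truncι {T : A} {i : ℤ} (a : T ⟶ X.X i) (h₀ : 0 ≤ i → a = 0)
    (h₁ : -1 ≤ i → a ≫ X.d i (i + 1) = 0) :
    ∃ b : T ⟶ (trunc X).X i, b ≫ (truncι X).f i = a :=
  ⟨kernel.lift _ a (comp_truncMap_eq_zero a h₀ h₁), kernel.lift_ι _ _ _⟩

lemma isZero_trunc_X (i : ℤ) (hi : 0 ≤ i) : IsZero ((trunc X).X i) := by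
  have h : (truncι X).f i = 0 := by
    have h := kernel.condition (truncMap X i) =≫ biprod.fst
    rw [zero_comp] at h
    change kernel.ι (truncMap X i) = 0
    simpa [truncMap, hi] using h
  rw [IsZero.iff_id_eq_zero, ← cancel_mono ((truncι X).f i), h]
  simp

variable {X}

lemma exists_hom_lift_truncι {T : CochainComplex A ℤ} (hT : ∀ i > -1, IsZero (T.X i))
    (φ : T ⟶ X) : ∃ ψ : T ⟶ trunc X, ψ ≫ truncι X = φ := by
  have H : ∀ i, ∃ b : T.X i ⟶ (trunc X).X i, b ≫ (truncι X).f i = φ.f i := fun i =>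
    exists_lift_truncι _ (fun hi => (hT i (by lia)).eq_of_src _ _) fun hi => by
      rw [φ.comm, (hT (i + 1) (by lia)).eq_of_tgt (T.d i (i + 1)) 0, zero_comp]
  choose b hb using H
  refine ⟨⟨b, fun i j _ => ?_⟩, ?_⟩
  · rw [← cancel_mono ((truncι X).f j), Category.assoc, Category.assoc, hb,
      ← (truncι X).comm, reassoc_of% hb, φ.comm]
  · ext i
    exact hb i

lemma nullHomotopic_of_comp_truncι {T : CochainComplex A ℤ} (hT : ∀ i > 0, IsZero (T.X i))
    (ψ : T ⟶ trunc X) (H : Homotopy (ψ ≫ truncι X) 0) : Nonempty (Homotopy ψ 0) := by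
  have hH : ∀ i j, ∃ b : T.X i ⟶ (trunc X).X j, b ≫ (truncι X).f j = H.hom i j := by
    intro i j
    by_cases hij : j + 1 = i
    swap
    · exact ⟨0, by rw [H.zero i j hij, zero_comp]⟩
    subst hij
    refine exists_lift_truncι _ (fun hj => (hT _ (by lia)).eq_of_src _ _) fun hj => ?_
    by_cases hj' : 0 ≤ j
    · exact (hT _ (by lia)).eq_of_src _ _
    have hc := H.comm (j + 1)
    rw [dNext_eq _ (show (ComplexShape.up ℤ).Rel (j + 1) (j + 1 + 1) by simp),
      prevD_eq _ (show (ComplexShape.up ℤ).Rel j (j + 1) by simp),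
      (hT (j + 1 + 1) (by lia)).eq_of_tgt (T.d (j + 1) (j + 1 + 1)) 0,
      HomologicalComplex.comp_f,
      (isZero_trunc_X X (j + 1) (by lia)).eq_of_tgt (ψ.f (j + 1)) 0] at hc
    simpa using hc.symm
  choose b hb using hH
  refine ⟨⟨b, fun i j hij => ?_, fun i => ?_⟩⟩
  · rw [← cancel_mono ((truncι X).f j), hb, H.zero i j hij, zero_comp]
  · have hc := H.comm i
    have r₁ : (ComplexShape.up ℤ).Rel i (i + 1) := by simp
    have r₂ : (ComplexShape.up ℤ).Rel (i - 1) i := by simp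
    rw [dNext_eq _ r₁, prevD_eq _ r₂] at hc ⊢
    rw [HomologicalComplex.zero_f, add_zero, HomologicalComplex.comp_f] at hc
    rw [← cancel_mono ((truncι X).f i), HomologicalComplex.zero_f, add_zero, hc,
      Preadditive.add_comp, Category.assoc, Category.assoc, hb, ← (truncι X).comm,
      reassoc_of% hb]

end Truncation

open Pretriangulated

section Triangle

variable {X Y Z : K(A)} {f : X ⟶ Y} {g : Y ⟶ Z} {h : Z ⟶ X⟦(1 : ℤ)⟧}

lemma exists_fac_mor₁ (hT : Triangle.mk f g h ∈ distTriang K(A))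
    {T : K(A)} (a : T ⟶ Y) (ha : a ≫ g = 0) : ∃ b : T ⟶ X, a = b ≫ f :=
  Triangle.coyoneda_exact₂ _ hT a ha

lemma exists_fac_mor₂ (hT : Triangle.mk f g h ∈ distTriang K(A))
    {T : K(A)} (a : T ⟶ Z) (ha : a ≫ h = 0) : ∃ b : T ⟶ Y, a = b ≫ g :=
  Triangle.coyoneda_exact₃ _ hT a ha

lemma exists_fac_mor₃ (hT : Triangle.mk f g h ∈ distTriang K(A)) {T : K(A)}
    (a : T ⟶ X⟦(1 : ℤ)⟧) (ha : a ≫ f⟦(1 : ℤ)⟧' = 0) : ∃ b : T ⟶ Z, a = b ≫ h :=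
  Triangle.coyoneda_exact₁ _ hT a ha

lemma exists_desc_mor₂ (hT : Triangle.mk f g h ∈ distTriang K(A))
    {T : K(A)} (a : Y ⟶ T) (ha : f ≫ a = 0) : ∃ b : Z ⟶ T, a = g ≫ b :=
  Triangle.yoneda_exact₂ _ hT a ha

lemma exists_desc_mor₃ (hT : Triangle.mk f g h ∈ distTriang K(A))
    {T : K(A)} (a : Z ⟶ T) (ha : g ≫ a = 0) :
    ∃ b : X⟦(1 : ℤ)⟧ ⟶ T, a = h ≫ b :=
  Triangle.yoneda_exact₃ _ hT a ha

lemma mor₁_comp_mor₂ (hT : Triangle.mk f g h ∈ distTriang K(A)) : f ≫ g = 0 := comp_distTriang_mor_zero₁₂ _ hT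

lemma mor₃_comp_mor₁ (hT : Triangle.mk f g h ∈ distTriang K(A)) : h ≫ f⟦(1 : ℤ)⟧' = 0 := comp_distTriang_mor_zero₃₁ _ hT

lemma exists_cone_map (hT : Triangle.mk f g h ∈ distTriang K(A)) {Y' Z' : K(A)} {k : Y ⟶ Y'}
    {g' : Y' ⟶ Z'} {h' : Z' ⟶ X⟦(1 : ℤ)⟧} (hT' : Triangle.mk (f ≫ k) g' h' ∈ distTriang K(A)) :
    ∃ m : Z ⟶ Z', g ≫ m = k ≫ g' ∧ m ≫ h' = h := by
  obtain ⟨m, hm₁, hm₂⟩ := complete_distinguished_triangle_morphism _ _ hT hT' (𝟙 X) k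
    (Category.id_comp _).symm
  refine ⟨m, hm₁, hm₂.symm.trans ?_⟩
  change h ≫ (shiftFunctor K(A) (1 : ℤ)).map (𝟙 X) = h
  rw [CategoryTheory.Functor.map_id, Category.comp_id]

end Triangle

/-- The standard cone of a morphism between complexes concentrated in nonpositive degrees is
concentrated in nonpositive degrees. -/
lemma exists_cone_termsLE {X Y : K(A)} (f : X ⟶ Y) (hX : TermsLE 0 X) (hY : TermsLE 0 Y) :
    ∃ (Z : K(A)) (g : Y ⟶ Z) (h : Z ⟶ X⟦(1 : ℤ)⟧),
      Triangle.mk f g h ∈ distTriang K(A) ∧ TermsLE 0 Z := by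
  obtain ⟨φ, rfl⟩ := Qh.map_surjective (X := X.as) (Y := Y.as) f
  refine ⟨_, _, _, HomotopyCategory.mappingCone_triangleh_distinguished φ, fun i hi => ?_⟩
  exact HomologicalComplex.homotopyCofiber.isZero_X φ i
    (hY i hi) (fun j (hj : i + 1 = j) => hX j (by lia))

lemma exists_truncation {X : K(A)} (hX : TermsLE 0 X) :
    ∃ (N X' : K(A)) (i : N ⟶ X) (p : X ⟶ X') (δ : X' ⟶ N⟦(1 : ℤ)⟧),
      Triangle.mk i p δ ∈ distTriang K(A) ∧ TermsLE (-1) N ∧ InHA X' := by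
  obtain ⟨X, rfl⟩ := HomotopyCategory.quotient_obj_surjective X
  have hN : TermsLE (-1) (Qh.obj (trunc X)) := fun i hi => isZero_trunc_X X i (by lia)
  obtain ⟨X', p, δ, hT, hX'⟩ := exists_cone_termsLE (X := Qh.obj (trunc X)) (Y := Qh.obj X)
    (Qh.map (truncι X)) (fun i hi => hN i (by lia)) hX
  refine ⟨_, X', _, p, δ, hT, hN, ⟨⟨0, hX'⟩, hX'⟩, ⟨0, hX'⟩, fun Y hY f => ?_⟩
  have hfδ : f ≫ δ = 0 := by
    obtain ⟨s, hs⟩ := (shiftFunctor K(A) (1 : ℤ)).map_surjective (f ≫ δ)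
    have h0 : s ≫ Qh.map (truncι X) = 0 := by
      apply (shiftFunctor K(A) (1 : ℤ)).map_injective
      rw [Functor.map_comp, hs, Functor.map_zero, Category.assoc, mor₃_comp_mor₁ hT,
        comp_zero]
    obtain ⟨Y, rfl⟩ := HomotopyCategory.quotient_obj_surjective Y
    obtain ⟨σ, rfl⟩ := Qh.map_surjective s
    rw [← hs]
    have hσ : Qh.map σ = 0 := by
      obtain ⟨H⟩ := (HomotopyCategory.quotient_map_eq_zero_iff (σ ≫ truncι X)).1
        (by rw [Functor.map_comp]; exact h0)
      exact (HomotopyCategory.quotient_map_eq_zero_iff σ).2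
        (nullHomotopic_of_comp_truncι hY.2 σ H)
    rw [hσ, Functor.map_zero]
  obtain ⟨g, rfl⟩ := exists_fac_mor₂ hT f hfδ
  obtain ⟨Z, hZ, ⟨e⟩⟩ := exists_shift Y
  obtain ⟨Z, rfl⟩ := HomotopyCategory.quotient_obj_surjective Z
  obtain ⟨φ, hφ⟩ := Qh.map_surjective (e.inv ≫ g)
  obtain ⟨ψ, rfl⟩ := exists_hom_lift_truncι
    (fun i hi => by
      have h := hZ i
      rw [HomotopyCategory.quotient_obj_as] at h
      rw [h]; exact hY.2 _ (by lia)) φ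
  have hg : g = e.hom ≫ Qh.map ψ ≫ Qh.map (truncι X) := by
    rw [← Functor.map_comp, ← Iso.inv_comp_eq]; exact hφ.symm
  rw [hg, Category.assoc, Category.assoc, mor₁_comp_mor₂ hT, comp_zero, comp_zero]

lemma _root_.IsCApprox.shift_injective {𝒞 : Set A} {Xc X : K(A)} {f : Xc ⟶ X} (hf : IsCApprox 𝒞 f)
    {T : K(A)} (hT : InTC 𝒞 T) (t : T ⟶ Xc⟦(1 : ℤ)⟧) (ht : t ≫ f⟦(1 : ℤ)⟧' = 0) : t = 0 := by
  obtain ⟨Y, hY, ⟨e⟩⟩ := exists_unshift T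
  obtain ⟨⟨N, hN⟩, hT⟩ := hT
  have hYC : InTC 𝒞 Y :=
    ⟨⟨N + 1, fun i hi => by rw [hY]; exact hN _ (by lia)⟩, fun i => by rw [hY]; exact hT _⟩
  obtain ⟨s, hs⟩ := (shiftFunctor K(A) (1 : ℤ)).map_surjective (e.hom ≫ t)
  have hsf : s ≫ f = 0 := by
    apply (shiftFunctor K(A) (1 : ℤ)).map_injective
    rw [Functor.map_comp, hs, Category.assoc, ht, comp_zero, Functor.map_zero]
  have hs0 : s = 0 := (hf.2.2 Y hYC).1 (by simpa using hsf)
  rw [hs0, Functor.map_zero] at hs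
  rwa [eq_comm, Preadditive.IsIso.comp_left_eq_zero] at hs

lemma _root_.IsCApprox.eq_zero {𝒞 : Set A} {Xc X : K(A)} {f : Xc ⟶ X} (hf : IsCApprox 𝒞 f)
    {T : K(A)} (hT : InTC 𝒞 T) (t : T ⟶ Xc) (ht : t ≫ f = 0) : t = 0 :=
  (hf.2.2 T hT).1 (by simpa using ht)

lemma _root_.IsCApprox.exists_lift {𝒞 : Set A} {Xc X : K(A)} {f : Xc ⟶ X} (hf : IsCApprox 𝒞 f)
    {T : K(A)} (hT : InTC 𝒞 T) (t : T ⟶ X) : ∃ s : T ⟶ Xc, s ≫ f = t :=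
  (hf.2.2 T hT).2 t

/-- The cone of a morphism `U ⟶ Xc` into a `𝒞`-approximation of `X` approximates the cone of the
composite `U ⟶ X`, as far as morphisms from complexes with terms in `𝒞` are concerned. -/
lemma _root_.IsCApprox.cone_bijective {𝒞 : Set A} {Xc X : K(A)} {f : Xc ⟶ X} (hf : IsCApprox 𝒞 f)
    {U D' D : K(A)} {g : U ⟶ Xc} {c' : Xc ⟶ D'} {d' : D' ⟶ U⟦(1 : ℤ)⟧}
    (hT' : Triangle.mk g c' d' ∈ distTriang K(A)) {c : X ⟶ D} {d : D ⟶ U⟦(1 : ℤ)⟧}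
    (hT : Triangle.mk (g ≫ f) c d ∈ distTriang K(A)) (m : D' ⟶ D) (hm₁ : c' ≫ m = f ≫ c)
    (hm₂ : m ≫ d = d') {T : K(A)} (hTC : InTC 𝒞 T) :
    Function.Bijective (fun y : T ⟶ D' => y ≫ m) := by
  constructor
  · intro y₁ y₂ hy
    rw [← sub_eq_zero]
    replace hy : (y₁ - y₂) ≫ m = 0 := by
      rw [Preadditive.sub_comp, sub_eq_zero]; exact hy
    obtain ⟨z, hz⟩ := exists_fac_mor₂ hT' (y₁ - y₂) (by
      rw [← hm₂, reassoc_of% hy, zero_comp])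
    obtain ⟨w, hw⟩ := exists_fac_mor₁ hT (z ≫ f) (by
      rw [Category.assoc, ← hm₁, ← Category.assoc, ← hz, hy])
    have hzw : z = w ≫ g := by
      rw [← sub_eq_zero]
      exact hf.eq_zero hTC _ (by rw [Preadditive.sub_comp, hw, Category.assoc, sub_self])
    rw [hz, hzw, Category.assoc, mor₁_comp_mor₂ hT', comp_zero]
  · intro x
    have hx : (x ≫ d) ≫ g⟦(1 : ℤ)⟧' = 0 := by
      refine hf.shift_injective hTC _ ?_
      rw [Category.assoc, Category.assoc, ← Functor.map_comp, mor₃_comp_mor₁ hT, comp_zero]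
    obtain ⟨y, hy⟩ := exists_fac_mor₃ hT' (x ≫ d) hx
    obtain ⟨z, hz⟩ := exists_fac_mor₂ hT (x - y ≫ m) (by
      rw [Preadditive.sub_comp, hy, Category.assoc, hm₂, sub_self])
    obtain ⟨z', rfl⟩ := hf.exists_lift hTC z
    refine ⟨y + z' ≫ c', ?_⟩
    dsimp only
    rw [Preadditive.add_comp, Category.assoc, hm₁, ← Category.assoc, ← hz, add_sub_cancel]

/-- The `𝒞`-approximation of an object of `H_A` is isomorphic to an object of `H_C`. -/
lemma _root_.IsCApprox.essInHC {𝒞 : Set A} (h𝒞 : IsAddKaroubi 𝒞) {Vc V : K(A)} {f : Vc ⟶ V}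
    (hf : IsCApprox 𝒞 f) (hV : InHA V) : EssInHC 𝒞 Vc := by
  obtain ⟨W, ⟨e⟩, hW, hWC⟩ := hf.exists_iso_termsLE h𝒞 hV.1.2
  refine ⟨W, ⟨⟨⟨⟨0, hW⟩, hW⟩, hWC⟩, ⟨⟨0, hW⟩, hWC⟩, fun Y hY g => ?_⟩, ⟨e⟩⟩
  obtain ⟨Z, hZ, ⟨e'⟩⟩ := exists_shift Y
  have hZC : InTC 𝒞 Z :=
    ⟨⟨0, fun i hi => by rw [hZ]; exact hY.1.2 _ (by lia)⟩, fun i => by rw [hZ]; exact hY.2 _⟩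
  have := hf.eq_zero hZC (e'.inv ≫ g ≫ e.hom) (by
    have := hV.2.2 Y hY.1 (g ≫ e.hom ≫ f)
    rw [Category.assoc, Category.assoc, this, comp_zero])
  rwa [Preadditive.IsIso.comp_left_eq_zero, Preadditive.IsIso.comp_right_eq_zero] at this

lemma comp_eq_zero_of_simple {𝒞 : Set A} (h𝒞 : IsAddKaroubi 𝒞) (happrox : CApproximating 𝒞)
    {V Vc : K(A)} (hV : InHA V) (hVs : SimpleIn EssInHA V) {f : Vc ⟶ V} (hf : IsCApprox 𝒞 f)
    {U W : K(A)} (hU : InHC 𝒞 U) (hW : InHC 𝒞 W) {g : U ⟶ Vc} (hg : g ≠ 0) (u : Vc ⟶ W)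
    (hgu : g ≫ u = 0) : u = 0 := by
  have hU₀ : TermsLE 0 U := hU.1.1.2
  obtain ⟨N₁, U', i₁, p, δ₁, hT₁, hN₁, hU'⟩ := exists_truncation hU₀
  obtain ⟨q, hq⟩ := exists_desc_mor₂ hT₁ (g ≫ f) (hV.2.eq_zero hN₁ _)
  have hq0 : q ≠ 0 := by
    rintro rfl
    exact hg (hf.eq_zero hU.2.1 g (by rw [hq, comp_zero]))
  obtain ⟨D, c, d, hT, hD⟩ := exists_cone_termsLE (g ≫ f) hU₀ hV.1.2
  obtain ⟨N, Q, b, r, δ, hT₂, hN, hQ⟩ := exists_truncation hD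
  have hqcr : q ≫ c ≫ r = 0 := by
    obtain ⟨t, ht⟩ := exists_desc_mor₃ hT₁ (q ≫ c ≫ r) (by
      rw [← Category.assoc, ← hq, ← Category.assoc, mor₁_comp_mor₂ hT, zero_comp])
    rw [ht, hQ.2.2 N₁ ⟨⟨-1, hN₁⟩, fun i hi => hN₁ i (by lia)⟩ t, comp_zero]
  have hcr : c ≫ r = 0 := hVs.2.2 U' ⟨U', hU', ⟨Iso.refl _⟩⟩ q hq0 Q ⟨Q, hQ, ⟨Iso.refl _⟩⟩ _ _
    (by rw [hqcr, comp_zero])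
  obtain ⟨a, ha⟩ := exists_fac_mor₁ hT₂ c hcr
  obtain ⟨Nc, n, hn⟩ := happrox N ⟨-1, hN⟩
  obtain ⟨N₀, ⟨e⟩, hN₀, hN₀C⟩ := hn.exists_iso_termsLE h𝒞 hN
  obtain ⟨l, hl⟩ := hn.exists_lift hf.1 (f ≫ a)
  obtain ⟨D', c', d', hT'⟩ := distinguished_cocone_triangle g
  obtain ⟨m, hm₁, hm₂⟩ := exists_cone_map hT' hT
  have hm := fun T (hTC : InTC 𝒞 T) =>
    hf.cone_bijective hT' hT m hm₁ hm₂ hTC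
  obtain ⟨y, hy⟩ := (hm Nc hn.1).2 (n ≫ b)
  have hly : l ≫ y = c' := (hm Vc hf.1).1 (by
    dsimp only at hy ⊢
    rw [Category.assoc, hy, ← Category.assoc, hl, Category.assoc, ← ha, hm₁])
  obtain ⟨u', rfl⟩ := exists_desc_mor₂ hT' u hgu
  have hyu : y ≫ u' = 0 := by
    have := hW.2.eq_zero hN₀ hN₀C (e.hom ≫ y ≫ u')
    rwa [Preadditive.IsIso.comp_left_eq_zero] at this
  rw [← hly, Category.assoc, hyu, comp_zero]

lemma _root_.IsCApprox.isZero_of_isZero {𝒞 : Set A} (h𝒞 : IsAddKaroubi 𝒞) {V Vc : K(A)}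
    (hV : InHA V) {f : Vc ⟶ V} (hf : IsCApprox 𝒞 f) (hV₀ : V.as.X 0 ∈ 𝒞) (hVc : IsZero Vc) :
    IsZero V := by
  obtain ⟨W, ⟨e⟩, hW, -⟩ := exists_iso_termsLE_pred V 0 hV.1.2 fun j => by
    obtain ⟨s, rfl⟩ := hf.exists_lift (inTC_single h𝒞 hV₀ 0) j
    rw [hVc.eq_of_tgt s 0, zero_comp]
  rw [IsZero.iff_id_eq_zero, ← e.inv_hom_id, hV.2.eq_zero hW e.hom, comp_zero]

end HomotopyHeart

/-!
STATEMENT 9: Assume `C` is `A`-approximating.  Let `V = [X → Y → Z]` be a simple object of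
`H_A`.  Then the `C`-approximation `π_C V` is either zero or a simple object of `H_C`;
and if moreover `Z = V⁰ ∈ C`, then `π_C V` is nonzero (hence simple).
-/
theorem statement9 {A : Type u} [Category.{v} A] [Abelian A]
    (𝒞 : Set A) (h𝒞 : IsAddKaroubi 𝒞) (happrox : CApproximating 𝒞) :
    ∀ V, InHA V → SimpleIn EssInHA V →
      ∀ (Vc : HomotopyCategory A (ComplexShape.up ℤ)) (f : Vc ⟶ V), IsCApprox 𝒞 f →
        (IsZero Vc ∨ SimpleIn (EssInHC 𝒞) Vc) ∧
        (V.as.X 0 ∈ 𝒞 → ¬ IsZero Vc) := by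
  intro V hV hVs Vc f hf
  refine ⟨or_iff_not_imp_left.2 fun hVc => ⟨hf.essInHC h𝒞 hV, hVc, ?_⟩,
    fun hV₀ hVc => hVs.2.1 (hf.isZero_of_isZero h𝒞 hV hV₀ hVc)⟩
  rintro U ⟨U₀, hU₀, ⟨eU⟩⟩ g hg W ⟨W₀, hW₀, ⟨eW⟩⟩ u v huv
  have h := HomotopyHeart.comp_eq_zero_of_simple h𝒞 happrox hV hVs hf hU₀ hW₀
    (g := eU.hom ≫ g) (by rwa [Ne, Preadditive.IsIso.comp_left_eq_zero])
    ((u - v) ≫ eW.inv) (by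
      rw [Category.assoc, ← Category.assoc g, Preadditive.comp_sub, sub_eq_zero.2 huv, zero_comp,
        comp_zero])
  rwa [Preadditive.IsIso.comp_right_eq_zero, sub_eq_zero] at h
end

section
/- Assume C is 𝒜-approximating. For V = [⋯ → C^{-1} → C^0] in H_C, let ρ_C V denote the cokernel, in the abelian category Mod C of additive functors C^{op} → Ab, of the induced morphism Hom_C(−, C^{-1}) → Hom_C(−, C^0). Then V is a simple object of H_C if and only if ρ_C V is a simple object of Mod C. Moreover, if 𝒜 is a Krull–Schmidt category, X ∈ C is indecomposable, and L_X = [⋯ → C^{-n} → ⋯ → C^{-1} → X] is a simple quotient of P_X in H_C, then ρ_C L_X ≅ Hom_C(−, X)/J(−, X), i.e. the sequence ⋯ → Hom_C(−, C^{-n}) → ⋯ → Hom_C(−, C^{-1}) → J(−, X) → 0 is exact, where J(Y, X) = {f : Y → X : f is not a split epimorphism} is the radical of Hom_C(−, X). -/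
open CategoryTheory Limits

universe v u

variable {A : Type u} [Category.{v} A] [Abelian A]

/-- `A` is a Krull–Schmidt category: every object is a finite direct sum of objects with
local endomorphism rings. -/
def KrullSchmidt (A : Type u) [Category.{v} A] [Abelian A] : Prop :=
  ∀ M : A, ∃ (n : ℕ) (Z : Fin n → A), (∀ i, IsLocalRing (End (Z i))) ∧
    haveI : HasFiniteBiproducts A := Limits.HasFiniteBiproducts.of_hasFiniteProducts
    Nonempty (M ≅ ⨁ Z)

/-- For `V ∈ H_C` (a bounded above complex `[⋯ → C⁻¹ → C⁰]` with terms in `C`) and `Y ∈ C`,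
the value `ρ_C V (Y) = Coker(Hom_C(Y, C⁻¹) → Hom_C(Y, C⁰))` of the functor `ρ_C V ∈ Mod C`
is canonically identified with `Hom_{K^-(C)}(P_Y, V)`, functorially in `Y`.  Under this
identification, an additive functor `F : Cᵒᵖ → Ab` is a simple object of `Mod C` iff `F ≠ 0`
and every nonzero element of `F` generates `F`; this is the following predicate. -/
def RhoSimple {A : Type u} [Category.{v} A] [Abelian A] (𝒞 : Set A)
    (V : HomotopyCategory A (ComplexShape.up ℤ)) : Prop :=
  (∃ Y ∈ 𝒞, ∃ y : PObj Y ⟶ V, y ≠ 0) ∧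
  ∀ Y ∈ 𝒞, ∀ y : PObj Y ⟶ V, y ≠ 0 →
    ∀ Z ∈ 𝒞, ∀ z : PObj Z ⟶ V, ∃ f : Z ⟶ Y, PMap f ≫ y = z

namespace HomotopyCategory

open HomologicalComplex

lemma quotient_map_eq_zero_iff_exists {X Y : CochainComplex A ℤ} (f : X ⟶ Y) :
    (quotient A (ComplexShape.up ℤ)).map f = 0 ↔
      ∃ s : ∀ i j : ℤ, X.X i ⟶ Y.X j,
        ∀ i, f.f i = X.d i (i + 1) ≫ s (i + 1) i + s i (i - 1) ≫ Y.d (i - 1) i := by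
  rw [quotient_map_eq_zero_iff]
  constructor
  · rintro ⟨h⟩
    refine ⟨h.hom, fun i ↦ ?_⟩
    have hi := h.comm i
    rw [dNext_eq h.hom (show (ComplexShape.up ℤ).Rel i (i + 1) by simp),
      prevD_eq h.hom (show (ComplexShape.up ℤ).Rel (i - 1) i by simp)] at hi
    simpa using hi
  · rintro ⟨s, hs⟩
    let t : ∀ i j : ℤ, X.X i ⟶ Y.X j := fun i j ↦ if j + 1 = i then s i j else 0
    refine ⟨{ hom := t, zero := fun i j hij ↦ if_neg hij, comm := fun i ↦ ?_ }⟩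
    rw [dNext_eq t (show (ComplexShape.up ℤ).Rel i (i + 1) by simp),
      prevD_eq t (show (ComplexShape.up ℤ).Rel (i - 1) i by simp)]
    simp [t, hs i]

lemma quotient_map_mkHomFromSingle_eq_zero_iff {Y : A} {V : CochainComplex A ℤ} {i j : ℤ}
    (g : Y ⟶ V.X i) (hg : ∀ k, (ComplexShape.up ℤ).Rel i k → g ≫ V.d i k = 0) (hji : j + 1 = i) :
    (quotient A (ComplexShape.up ℤ)).map (mkHomFromSingle g hg) = 0 ↔
      ∃ s : Y ⟶ V.X j, s ≫ V.d j i = g := by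
  obtain rfl : j = i - 1 := by omega
  rw [quotient_map_eq_zero_iff_exists]
  constructor
  · rintro ⟨s, hs⟩
    refine ⟨(singleObjXSelf (ComplexShape.up ℤ) i Y).inv ≫ s i (i - 1), ?_⟩
    have := hs i
    rw [mkHomFromSingle_f, single_obj_d, zero_comp, zero_add] at this
    rw [Category.assoc, ← this, Iso.inv_hom_id_assoc]
  · rintro ⟨s, hs⟩
    refine ⟨fun a b ↦ if h : a = i ∧ b = i - 1 then
      (singleObjXIsoOfEq (ComplexShape.up ℤ) i Y a h.1).hom ≫ s ≫ (V.XIsoOfEq h.2).inv else 0,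
      fun a ↦ ?_⟩
    by_cases ha : a = i
    · subst ha
      beta_reduce
      rw [mkHomFromSingle_f, single_obj_d, zero_comp, zero_add, dif_pos ⟨rfl, rfl⟩, ← hs]
      simp [singleObjXSelf]
    · exact (isZero_single_obj_X (ComplexShape.up ℤ) i Y a ha).eq_of_src _ _

/-- Up to isomorphism, a complex concentrated in degrees `≤ -1` is the shift of a complex
concentrated in degrees `≤ 0`. -/
lemma quotient_map_eq_zero_of_forall_shift {𝒞 : Set A} {U V : CochainComplex A ℤ}
    (hV : ∀ Y, InTleC 𝒞 Y → ∀ f : Y⟦(1 : ℤ)⟧ ⟶ (quotient A (ComplexShape.up ℤ)).obj V, f = 0)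
    (hU : ∀ i, U.X i ∈ 𝒞) (hU' : ∀ i, 0 ≤ i → IsZero (U.X i)) (φ : U ⟶ V) :
    (quotient A (ComplexShape.up ℤ)).map φ = 0 := by
  let e : (U⟦(-1 : ℤ)⟧)⟦(1 : ℤ)⟧ ≅ U :=
    (shiftFunctorCompIsoId (CochainComplex A ℤ) (-1 : ℤ) 1 (by simp)).app U
  have h0 : ∀ i > 0, IsZero ((U⟦(-1 : ℤ)⟧).X i) := fun i hi ↦ hU' (i + -1) (by omega)
  have h := hV ((quotient A (ComplexShape.up ℤ)).obj (U⟦(-1 : ℤ)⟧))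
    ⟨⟨⟨0, h0⟩, h0⟩, fun i ↦ hU (i + -1)⟩
    ((((quotient A (ComplexShape.up ℤ)).commShiftIso (1 : ℤ)).app (U⟦(-1 : ℤ)⟧)).inv ≫
      (quotient A (ComplexShape.up ℤ)).map (e.hom ≫ φ))
  rw [Iso.inv_comp_eq, comp_zero, Functor.map_comp] at h
  exact (cancel_epi ((quotient A (ComplexShape.up ℤ)).map e.hom)).1 (by rw [h, comp_zero])

/-- A morphism from a complex `U` in degrees `≤ 0` vanishes if its degree `0` component is
null-homotopic and the target is right orthogonal to complexes in degrees `≤ -1`: it then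
factors through the brutal truncation of `U` in degrees `≤ -1`. -/
lemma quotient_map_eq_zero_of_f_zero {𝒞 : Set A} (h𝒞 : IsAddKaroubi 𝒞) {U V : CochainComplex A ℤ}
    (hV : ∀ Y, InTleC 𝒞 Y → ∀ f : Y⟦(1 : ℤ)⟧ ⟶ (quotient A (ComplexShape.up ℤ)).obj V, f = 0)
    (hU : ∀ i, U.X i ∈ 𝒞) (hU' : ∀ i, 0 < i → IsZero (U.X i)) (φ : U ⟶ V)
    (s : U.X 0 ⟶ V.X (-1)) (hs : φ.f 0 = s ≫ V.d (-1) 0) :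
    (quotient A (ComplexShape.up ℤ)).map φ = 0 := by
  let h : ∀ i j : ℤ, (ComplexShape.up ℤ).Rel j i → (U.X i ⟶ V.X j) := fun i j _ ↦
    if hij : i = 0 ∧ j = -1 then (U.XIsoOfEq hij.1).hom ≫ s ≫ (V.XIsoOfEq hij.2).inv else 0
  let φ' : U ⟶ V := φ - Homotopy.nullHomotopicMap' h
  have hφ' : (quotient A (ComplexShape.up ℤ)).map φ = (quotient A (ComplexShape.up ℤ)).map φ' := by
    rw [Functor.map_sub, eq_of_homotopy _ _ (Homotopy.nullHomotopy' h), Functor.map_zero, sub_zero]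
  have hφ'₀ : φ'.f 0 = 0 := by
    rw [HomologicalComplex.sub_f_apply, Homotopy.nullHomotopicMap'_f
      (show (ComplexShape.up ℤ).Rel (-1) 0 by simp) (show (ComplexShape.up ℤ).Rel 0 1 by simp),
      hs]
    simp [h]
  let e := ComplexShape.embeddingUpIntLE (-1)
  have he : ∀ i : ℤ, i ≤ -1 → e.f (-1 - i).toNat = i := fun i hi ↦ by
    change (-1 : ℤ) - ((-1 - i).toNat : ℤ) = i
    omega
  have he' : ∀ i : ℤ, -1 < i → ∀ n, e.f n ≠ i := fun i hi n ↦ by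
    change (-1 : ℤ) - (n : ℤ) ≠ i
    omega
  let T := U.stupidTrunc e
  let p : U ⟶ T := e.liftExtend (𝟙 _) (fun _ hj ↦ hj.false_of_isTruncLE.elim)
  have hp : ∀ i, i ≤ -1 → IsIso (p.f i) := fun i hi ↦
    (e.isIso_liftExtend_f_iff _ _ (he i hi)).2 (by rw [id_f]; infer_instance)
  let ψ : T ⟶ V :=
    { f i := if hi : i ≤ -1 then haveI := hp i hi; inv (p.f i) ≫ φ'.f i else 0
      comm' i j hij := by
        obtain rfl : i + 1 = j := hij
        by_cases hi : i + 1 ≤ -1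
        · have := hp _ hi
          have := hp i (by omega)
          rw [dif_pos hi, dif_pos (by omega), ← cancel_epi (p.f i), Category.assoc,
            IsIso.hom_inv_id_assoc, φ'.comm, p.comm_assoc, IsIso.hom_inv_id_assoc]
        · rw [dif_neg hi, comp_zero]
          split_ifs with hi'
          · have := hp i hi'
            obtain rfl : i = -1 := by omega
            simp [hφ'₀]
          · simp }
  have hpψ : p ≫ ψ = φ' := by
    ext i
    by_cases hi : i ≤ -1
    · have := hp i hi
      simp [ψ, hi]
    · obtain rfl | hi' : i = 0 ∨ 0 < i := by omega
      · simp [ψ, hφ'₀]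
      · exact (hU' i hi').eq_of_src _ _
  have hT : ∀ i, 0 ≤ i → IsZero (T.X i) := fun i hi ↦
    U.isZero_stupidTrunc_X e i (he' i (by omega))
  rw [hφ', ← hpψ, Functor.map_comp, quotient_map_eq_zero_of_forall_shift hV (fun i ↦ ?_) hT ψ,
    comp_zero]
  by_cases hi : i ≤ -1
  · have := hp i hi
    exact h𝒞.iso (asIso (p.f i)) (hU i)
  · exact h𝒞.zero _ (hT i (by omega))

lemma isIso_ιTruncLE_f (K : CochainComplex A ℤ) (n i : ℤ) (hi : i < n) :
    IsIso ((CochainComplex.ιTruncLE K n).f i) := by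
  let e := ComplexShape.embeddingUpIntLE n
  have he : e.op.f (n - i).natAbs = i := by
    change n - ((n - i).natAbs : ℤ) = i
    omega
  have : IsIso ((K.op.πTruncGE e.op).f i) := by
    refine (e.op.isIso_liftExtend_f_iff _ _ he).2 (K.op.isIso_restrictionToTruncGE' e.op _ ?_)
    rw [ComplexShape.Embedding.op_boundaryGE_iff, ComplexShape.boundaryLE_embeddingUpIntLE_iff]
    omega
  exact inferInstanceAs (IsIso ((K.op.πTruncGE e.op).f i).unop)

lemma cycles_mem {𝒞 : Set A} (h𝒞 : IsAddKaroubi 𝒞) {K : CochainComplex A ℤ} (hK : ∀ i, K.X i ∈ 𝒞)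
    {N : ℤ} (hN : ∀ i > N, IsZero (K.X i))
    (hs : ∀ i j : ℤ, 0 ≤ i → i + 1 = j → ∀ Y ∈ 𝒞, ∀ g : Y ⟶ K.X j, g ≫ K.d j (j + 1) = 0 →
      ∃ s : Y ⟶ K.X i, s ≫ K.d i j = g) (i : ℤ) (hi : 0 ≤ i) :
    K.cycles i ∈ 𝒞 := by
  have key : ∀ (n : ℕ) (i : ℤ), 0 ≤ i → N < i + n → K.cycles i ∈ 𝒞 := by
    intro n
    induction n with
    | zero =>
      intro i _ hiN
      refine h𝒞.zero _ ((hN i (by simpa using hiN)).of_mono (K.iCycles i))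
    | succ n ih =>
      intro i hi hiN
      obtain ⟨σ, hσ⟩ := hs i (i + 1) hi rfl _ (ih (i + 1) (by omega) (by push_cast at hiN; omega))
        (K.iCycles (i + 1)) (by simp)
      let q := K.toCycles i (i + 1)
      have hq : q ≫ K.iCycles (i + 1) = K.d i (i + 1) := K.toCycles_i _ _
      refine h𝒞.summand (hK i) (K.iCycles i)
        (K.liftCycles (𝟙 _ - q ≫ σ) (i + 1) (by simp) (by simp [hσ, hq])) ?_
      rw [← cancel_mono (K.iCycles i)]
      have : K.iCycles i ≫ q = 0 := by
        rw [← cancel_mono (K.iCycles (i + 1)), Category.assoc, hq, K.iCycles_d, zero_comp]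
      simp [reassoc_of% this]
  exact key (N + 1 - i).toNat i hi (by omega)

/-- A morphism from a complex in degrees `≤ 0` factors through the canonical truncation. -/
lemma exists_comp_ιTruncLE {U K : CochainComplex A ℤ} (hU : ∀ i > 0, IsZero (U.X i)) (φ : U ⟶ K) :
    ∃ ψ : U ⟶ K.truncLE 0, ψ ≫ K.ιTruncLE 0 = φ := by
  have : U.IsStrictlyLE 0 := (U.isStrictlyLE_iff 0).2 hU
  have : IsIso (CochainComplex.ιTruncLE U 0) :=
    inferInstanceAs (IsIso (HomologicalComplex.ιTruncLE U _))
  exact ⟨inv (U.ιTruncLE 0) ≫ CochainComplex.truncLEMap φ 0, by simp⟩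

lemma quotient_map_eq_zero_of_comp_ιTruncLE {U K : CochainComplex A ℤ}
    (hU : ∀ i > 0, IsZero (U.X i)) (ψ : U ⟶ K.truncLE 0)
    (h : (quotient A (ComplexShape.up ℤ)).map (ψ ≫ K.ιTruncLE 0) = 0) :
    (quotient A (ComplexShape.up ℤ)).map ψ = 0 := by
  rw [quotient_map_eq_zero_iff_exists] at h ⊢
  obtain ⟨s, hs⟩ := h
  refine ⟨fun i j ↦ if hj : j < 0 then
    haveI := isIso_ιTruncLE_f K 0 j hj
    s i j ≫ inv ((K.ιTruncLE 0).f j) else 0, fun i ↦ ?_⟩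
  obtain hi | hi := lt_or_ge 0 i
  · exact (hU i hi).eq_of_src _ _
  have : Mono ((K.ιTruncLE 0).f i) := inferInstanceAs (Mono ((HomologicalComplex.ιTruncLE K _).f i))
  have := isIso_ιTruncLE_f K 0 (i - 1) (by omega)
  rw [← cancel_mono ((K.ιTruncLE 0).f i), ← HomologicalComplex.comp_f, hs]
  beta_reduce
  have e : (s i (i - 1) ≫ inv ((K.ιTruncLE 0).f (i - 1))) ≫ (K.truncLE 0).d (i - 1) i ≫
      (K.ιTruncLE 0).f i = s i (i - 1) ≫ K.d (i - 1) i := by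
    rw [Category.assoc, ← (K.ιTruncLE 0).comm, IsIso.inv_hom_id_assoc]
  rw [Preadditive.add_comp, dif_pos (show i - 1 < 0 by omega),
    Category.assoc (s i (i - 1) ≫ _), e]
  obtain hi' | rfl := lt_or_eq_of_le hi
  · rw [dif_pos hi']
    simp
  · have : U.d 0 (0 + 1) = 0 := (hU (0 + 1) (by omega)).eq_of_tgt _ _
    rw [this]
    simp

section KernelComplex

variable {W₁ W₀ : A} (w : W₁ ⟶ W₀)

open scoped ZeroObject in
/-- The complex `ker w ⟶ W₁ ⟶ W₀` placed in degrees `-2`, `-1` and `0`. -/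
noncomputable def kernelComplex : CochainComplex A ℤ where
  X
    | .ofNat 0 => W₀
    | .ofNat (_ + 1) => 0
    | .negSucc 0 => W₁
    | .negSucc 1 => kernel w
    | .negSucc (_ + 2) => 0
  d i j := match i, j with
    | .negSucc 1, .negSucc 0 => kernel.ι w
    | .negSucc 0, .ofNat 0 => w
    | _, _ => 0
  shape i j hij := by
    split
    · exact (hij rfl).elim
    · exact (hij rfl).elim
    · rfl
  d_comp_d' i j k _ _ := by
    rcases i with i | (_ | _ | i) <;> rcases j with (_ | j) | (_ | _ | j) <;>
      rcases k with (_ | k) | (_ | _ | k) <;>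
      first | exact zero_comp | exact comp_zero | exact kernel.condition w

lemma isZero_kernelComplex_X {i : ℤ} (hi : 0 < i ∨ i < -2) : IsZero ((kernelComplex w).X i) := by
  obtain hi | hi := hi
  · obtain ⟨n, rfl⟩ : ∃ n : ℕ, i = Int.ofNat (n + 1) := ⟨(i - 1).toNat, by simp; omega⟩
    exact Limits.isZero_zero A
  · obtain ⟨n, rfl⟩ : ∃ n : ℕ, i = Int.negSucc (n + 2) := ⟨(-3 - i).toNat, by omega⟩
    exact Limits.isZero_zero A

lemma kernelComplex_lift {Y : A} (g : Y ⟶ (kernelComplex w).X (-1))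
    (hg : g ≫ (kernelComplex w).d (-1) 0 = 0) :
    ∃ s : Y ⟶ (kernelComplex w).X (-2), s ≫ (kernelComplex w).d (-2) (-1) = g :=
  ⟨kernel.lift w g hg, kernel.lift_ι w g hg⟩

lemma exists_hom_kernelComplex {V : CochainComplex A ℤ} (a : V.X (-1) ⟶ W₁) (b : V.X 0 ⟶ W₀)
    (hab : a ≫ w = V.d (-1) 0 ≫ b) : ∃ t : V ⟶ kernelComplex w, t.f 0 = b := by
  have h : (V.d (-2) (-1) ≫ a) ≫ w = 0 := by simp [hab]
  refine ⟨{
    f := fun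
      | .ofNat 0 => b
      | .ofNat (_ + 1) => 0
      | .negSucc 0 => a
      | .negSucc 1 => kernel.lift w (V.d (-2) (-1) ≫ a) h
      | .negSucc (_ + 2) => 0
    comm' := fun i j hij ↦ ?_ }, rfl⟩
  obtain rfl : i + 1 = j := hij
  obtain hi | rfl | rfl | rfl | hi : 0 ≤ i ∨ i = -1 ∨ i = -2 ∨ i = -3 ∨ i < -3 := by omega
  · exact (isZero_kernelComplex_X w (Or.inl (by omega))).eq_of_tgt _ _
  · exact hab
  · exact kernel.lift_ι w _ h
  · refine Eq.trans zero_comp (Eq.symm ?_)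
    change V.d (-3) (-2) ≫ kernel.lift w (V.d (-2) (-1) ≫ a) h = 0
    rw [← cancel_mono (kernel.ι w)]
    simp
  · exact (isZero_kernelComplex_X w (Or.inr (by omega))).eq_of_tgt _ _

lemma quotient_map_kernelComplex_eq_zero {U : CochainComplex A ℤ}
    (hU : ∀ i, 0 ≤ i → IsZero (U.X i)) (φ : U ⟶ kernelComplex w) :
    (quotient A (ComplexShape.up ℤ)).map φ = 0 := by
  obtain ⟨s, hs⟩ := kernelComplex_lift w (φ.f (-1))
    (by rw [φ.comm, (hU 0 le_rfl).eq_of_tgt (U.d (-1) 0) 0, zero_comp])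
  rw [quotient_map_eq_zero_iff_exists]
  let t : ∀ i j : ℤ, U.X i ⟶ (kernelComplex w).X j := fun i j ↦
    if h : i = -1 ∧ j = -2 then
      (U.XIsoOfEq h.1).hom ≫ s ≫ ((kernelComplex w).XIsoOfEq h.2).inv else 0
  refine ⟨t, fun i ↦ ?_⟩
  obtain hi | rfl | rfl | hi : i < -2 ∨ i = -2 ∨ i = -1 ∨ 0 ≤ i := by omega
  · exact (isZero_kernelComplex_X w (Or.inr hi)).eq_of_tgt _ _
  · have : Mono ((kernelComplex w).d (-2) (-2 + 1)) := inferInstanceAs (Mono (kernel.ι w))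
    rw [show t (-2) (-2 - 1) = 0 from dif_neg (by omega), zero_comp, add_zero,
      ← cancel_mono ((kernelComplex w).d (-2) (-2 + 1)), φ.comm, Category.assoc]
    simp [t, hs]
  · simp [t, hs]
  · exact (hU i hi).eq_of_src _ _

end KernelComplex

section Single

/-- For a complex `V` in degrees `≤ 0`, the morphism `P_Y ⟶ V` given by a morphism `Y ⟶ V⁰`. -/
noncomputable def fromPObj {V : CochainComplex A ℤ} (hV : ∀ i > 0, IsZero (V.X i)) {Y : A}
    (g : Y ⟶ V.X 0) : PObj Y ⟶ (quotient A (ComplexShape.up ℤ)).obj V :=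
  (quotient A (ComplexShape.up ℤ)).map (mkHomFromSingle g (fun k hk ↦
    (hV k (by rw [ComplexShape.up_Rel] at hk; omega)).eq_of_tgt _ _))

section

variable {V W : CochainComplex A ℤ} (hV : ∀ i > 0, IsZero (V.X i))
  (hW : ∀ i > 0, IsZero (W.X i)) {Y Z : A}

lemma fromPObj_surjective : Function.Surjective (fromPObj hV (Y := Y)) := by
  intro f
  obtain ⟨f, rfl⟩ := (quotient A (ComplexShape.up ℤ)).map_surjective
    (X := (single A (ComplexShape.up ℤ) 0).obj Y) f
  refine ⟨(singleObjXSelf (ComplexShape.up ℤ) 0 Y).inv ≫ f.f 0,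
    congrArg (quotient A (ComplexShape.up ℤ)).map ?_⟩
  apply from_single_hom_ext
  rw [mkHomFromSingle_f, Iso.hom_inv_id_assoc]

lemma PMap_comp_fromPObj (f : Z ⟶ Y) (g : Y ⟶ V.X 0) :
    PMap f ≫ fromPObj hV g = fromPObj hV (f ≫ g) := by
  refine ((quotient A (ComplexShape.up ℤ)).map_comp _ _).symm.trans (congrArg _ ?_)
  apply from_single_hom_ext
  simp [single_map_f_self]

lemma fromPObj_comp_quotient_map (g : Y ⟶ V.X 0) (φ : V ⟶ W) :
    fromPObj hV g ≫ (quotient A (ComplexShape.up ℤ)).map φ = fromPObj hW (g ≫ φ.f 0) := by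
  refine ((quotient A (ComplexShape.up ℤ)).map_comp _ _).symm.trans (congrArg _ ?_)
  apply from_single_hom_ext
  simp

lemma fromPObj_sub (g g' : Y ⟶ V.X 0) :
    fromPObj hV (g - g') = fromPObj hV g - fromPObj hV g' := by
  refine Eq.trans (congrArg (quotient A (ComplexShape.up ℤ)).map ?_)
    (quotient A (ComplexShape.up ℤ)).map_sub
  apply from_single_hom_ext
  simp

lemma fromPObj_eq_zero_iff (g : Y ⟶ V.X 0) :
    fromPObj hV g = 0 ↔ ∃ s : Y ⟶ V.X (-1), s ≫ V.d (-1) 0 = g :=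
  quotient_map_mkHomFromSingle_eq_zero_iff g _ (by simp)

lemma fromPObj_eq_iff (g g' : Y ⟶ V.X 0) :
    fromPObj hV g = fromPObj hV g' ↔ ∃ s : Y ⟶ V.X (-1), s ≫ V.d (-1) 0 = g - g' := by
  rw [← sub_eq_zero, ← fromPObj_sub, fromPObj_eq_zero_iff]

end

lemma single_X_mem {𝒞 : Set A} (h𝒞 : IsAddKaroubi 𝒞) {Y : A} (hY : Y ∈ 𝒞) (n i : ℤ) :
    ((single A (ComplexShape.up ℤ) n).obj Y).X i ∈ 𝒞 := by
  by_cases h : i = n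
  · exact h𝒞.iso (singleObjXIsoOfEq (ComplexShape.up ℤ) n Y i h).symm hY
  · exact h𝒞.zero _ (isZero_single_obj_X _ _ _ _ h)

lemma inTC_single {𝒞 : Set A} (h𝒞 : IsAddKaroubi 𝒞) {Y : A} (hY : Y ∈ 𝒞) (n : ℤ) :
    InTC 𝒞 ((quotient A (ComplexShape.up ℤ)).obj ((single A (ComplexShape.up ℤ) n).obj Y)) :=
  ⟨⟨n, fun i hi ↦ isZero_single_obj_X _ _ _ _ (by omega)⟩, single_X_mem h𝒞 hY n⟩

end Single

lemma inTleC_iff {𝒞 : Set A} {U : CochainComplex A ℤ} :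
    InTleC 𝒞 ((quotient A (ComplexShape.up ℤ)).obj U) ↔
      (∀ i > 0, IsZero (U.X i)) ∧ ∀ i, U.X i ∈ 𝒞 :=
  ⟨fun h ↦ ⟨h.1.2, h.2⟩, fun h ↦ ⟨⟨⟨0, h.1⟩, h.1⟩, h.2⟩⟩

/-- Membership in the heart can be tested on shifts of complexes before passing to the homotopy
category. -/
lemma inHC_of_forall_shift {𝒞 : Set A} {V : CochainComplex A ℤ} (hV : ∀ i > 0, IsZero (V.X i))
    (hV' : ∀ i, V.X i ∈ 𝒞)
    (h : ∀ U : CochainComplex A ℤ, (∀ i, U.X i ∈ 𝒞) → (∀ i, 0 ≤ i → IsZero (U.X i)) →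
      ∀ f : U ⟶ V, (quotient A (ComplexShape.up ℤ)).map f = 0) :
    InHC 𝒞 ((quotient A (ComplexShape.up ℤ)).obj V) := by
  refine ⟨inTleC_iff.2 ⟨hV, hV'⟩, ⟨⟨0, hV⟩, hV'⟩, fun U hU f ↦ ?_⟩
  obtain ⟨U, rfl⟩ := quotient_obj_surjective U
  rw [inTleC_iff] at hU
  rw [← cancel_epi (((quotient A (ComplexShape.up ℤ)).commShiftIso (1 : ℤ)).app U).hom, comp_zero]
  obtain ⟨g, hg⟩ := (quotient A (ComplexShape.up ℤ)).map_surjective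
    ((((quotient A (ComplexShape.up ℤ)).commShiftIso (1 : ℤ)).app U).hom ≫ f)
  rw [← hg]
  exact h (U⟦(1 : ℤ)⟧) (fun i ↦ hU.2 (i + 1)) (fun i hi ↦ hU.1 (i + 1) (by omega)) g

lemma inHC_PObj {𝒞 : Set A} (h𝒞 : IsAddKaroubi 𝒞) {Y : A} (hY : Y ∈ 𝒞) : InHC 𝒞 (PObj Y) := by
  refine inHC_of_forall_shift (fun i hi ↦ isZero_single_obj_X _ _ _ _ (by omega))
    (single_X_mem h𝒞 hY 0) (fun U _ hU f ↦ ?_)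
  have : f = 0 := by
    refine hom_ext _ _ (fun i ↦ ?_)
    by_cases hi : i = 0
    · subst hi
      exact (hU 0 le_rfl).eq_of_src _ _
    · exact (isZero_single_obj_X (ComplexShape.up ℤ) 0 Y i hi).eq_of_tgt _ _
  rw [this, Functor.map_zero]

lemma exists_inHC_approximation {𝒞 : Set A} (h𝒞 : IsAddKaroubi 𝒞) (happrox : CApproximating 𝒞)
    {W₁ W₀ : A} (w : W₁ ⟶ W₀) {V : CochainComplex A ℤ} (hV : ∀ i > 0, IsZero (V.X i))
    (hV' : ∀ i, V.X i ∈ 𝒞) (t : V ⟶ kernelComplex w) :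
    ∃ (Z : CochainComplex A ℤ) (t' : V ⟶ Z)
      (c : (quotient A (ComplexShape.up ℤ)).obj Z ⟶
        (quotient A (ComplexShape.up ℤ)).obj (kernelComplex w)),
      InHC 𝒞 ((quotient A (ComplexShape.up ℤ)).obj Z) ∧
      (quotient A (ComplexShape.up ℤ)).map t' ≫ c = (quotient A (ComplexShape.up ℤ)).map t ∧
      ∀ U : CochainComplex A ℤ, (∀ i > 0, IsZero (U.X i)) → (∀ i, U.X i ∈ 𝒞) →
        ∀ f : U ⟶ Z, (quotient A (ComplexShape.up ℤ)).map f ≫ c = 0 →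
          (quotient A (ComplexShape.up ℤ)).map f = 0 := by
  obtain ⟨Q, φ, ⟨⟨⟨N, hN⟩, hQ⟩, -, hφ⟩⟩ := happrox
    ((quotient A (ComplexShape.up ℤ)).obj (kernelComplex w))
    ⟨0, fun i hi ↦ isZero_kernelComplex_X w (Or.inl hi)⟩
  obtain ⟨Q, rfl⟩ := quotient_obj_surjective Q
  obtain ⟨φ, rfl⟩ := (quotient A (ComplexShape.up ℤ)).map_surjective φ
  have hinj : ∀ U : CochainComplex A ℤ, InTC 𝒞 ((quotient A (ComplexShape.up ℤ)).obj U) →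
      ∀ f : U ⟶ Q, (quotient A (ComplexShape.up ℤ)).map (f ≫ φ) = 0 →
        (quotient A (ComplexShape.up ℤ)).map f = 0 := fun U hU f hf ↦
    (hφ _ hU).1 (by simpa using hf)
  have hcyc := cycles_mem h𝒞 hQ hN (fun i j hi hij Y hY g hg ↦ by
    have hg' : ∀ k, (ComplexShape.up ℤ).Rel j k → g ≫ Q.d j k = 0 := by
      rintro k rfl
      exact hg
    refine (quotient_map_mkHomFromSingle_eq_zero_iff g hg' hij).1
      (hinj _ (inTC_single h𝒞 hY j) _ ?_)
    refine Eq.trans (congrArg _ ?_) (Functor.map_zero (quotient A (ComplexShape.up ℤ)) _ _)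
    apply from_single_hom_ext
    exact (isZero_kernelComplex_X w (Or.inl (by omega))).eq_of_tgt _ _)
  have hreflect : ∀ U : CochainComplex A ℤ, (∀ i > 0, IsZero (U.X i)) → (∀ i, U.X i ∈ 𝒞) →
      ∀ f : U ⟶ CochainComplex.truncLE Q 0,
        (quotient A (ComplexShape.up ℤ)).map (f ≫ CochainComplex.ιTruncLE Q 0 ≫ φ) = 0 →
          (quotient A (ComplexShape.up ℤ)).map f = 0 := fun U hU hU' f hf ↦
    quotient_map_eq_zero_of_comp_ιTruncLE hU f
      (hinj U ⟨⟨0, hU⟩, hU'⟩ _ (by rwa [Category.assoc]))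
  have h0 : ∀ i > (0 : ℤ), IsZero ((CochainComplex.truncLE Q 0).X i) :=
    fun i hi ↦ CochainComplex.isZero_of_isStrictlyLE _ 0 i hi
  have hmem : ∀ i, (CochainComplex.truncLE Q 0).X i ∈ 𝒞 := fun i ↦ by
    obtain hi | rfl | hi := lt_trichotomy i 0
    · exact h𝒞.iso (CochainComplex.truncLEXIso Q 0 i hi).symm (hQ i)
    · exact h𝒞.iso (CochainComplex.truncLEXIsoCycles Q 0).symm (hcyc 0 le_rfl)
    · exact h𝒞.zero _ (h0 i hi)
  obtain ⟨t₁, ht₁⟩ := (hφ _ ⟨⟨0, hV⟩, hV'⟩).2 ((quotient A (ComplexShape.up ℤ)).map t)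
  obtain ⟨t₁, rfl⟩ := (quotient A (ComplexShape.up ℤ)).map_surjective t₁
  obtain ⟨t₂, rfl⟩ := exists_comp_ιTruncLE hV t₁
  refine ⟨_, t₂, (quotient A (ComplexShape.up ℤ)).map (CochainComplex.ιTruncLE Q 0 ≫ φ),
    inHC_of_forall_shift h0 hmem (fun U hU hU' f ↦ ?_), ?_,
    fun U hU hU' f hf ↦ hreflect U hU hU' f (by rwa [← Functor.map_comp] at hf)⟩
  · exact hreflect U (fun i hi ↦ hU' i hi.le) hU f (quotient_map_kernelComplex_eq_zero w hU' _)
  · rwa [Functor.map_comp, ← Category.assoc, ← Functor.map_comp]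

section Heart

variable {𝒞 : Set A}

lemma eq_zero_of_fromPObj_id_comp (h𝒞 : IsAddKaroubi 𝒞) {U : CochainComplex A ℤ}
    (hU : ∀ i > 0, IsZero (U.X i)) (hU' : ∀ i, U.X i ∈ 𝒞)
    {Z : HomotopyCategory A (ComplexShape.up ℤ)} (hZ : EssInHC 𝒞 Z)
    (u : (quotient A (ComplexShape.up ℤ)).obj U ⟶ Z) (h : fromPObj hU (𝟙 (U.X 0)) ≫ u = 0) :
    u = 0 := by
  obtain ⟨V, hV, ⟨e⟩⟩ := hZ
  obtain ⟨V, rfl⟩ := quotient_obj_surjective V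
  obtain ⟨φ, hφ⟩ := (quotient A (ComplexShape.up ℤ)).map_surjective (u ≫ e.inv)
  rw [← cancel_mono e.inv, Category.assoc, zero_comp, ← hφ,
    fromPObj_comp_quotient_map hU (inTleC_iff.1 hV.1).1, fromPObj_eq_zero_iff] at h
  obtain ⟨s, hs⟩ := h
  rw [← cancel_mono e.inv, ← hφ, zero_comp]
  exact quotient_map_eq_zero_of_f_zero h𝒞 hV.2.2 hU' hU φ s (by simpa using hs.symm)

lemma simpleIn_of_rhoSimple (h𝒞 : IsAddKaroubi 𝒞) {V : CochainComplex A ℤ}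
    (hV : InHC 𝒞 ((quotient A (ComplexShape.up ℤ)).obj V))
    (h : RhoSimple 𝒞 ((quotient A (ComplexShape.up ℤ)).obj V)) :
    SimpleIn (EssInHC 𝒞) ((quotient A (ComplexShape.up ℤ)).obj V) := by
  have hV' := inTleC_iff.1 hV.1
  have hV'' : EssInHC 𝒞 ((quotient A (ComplexShape.up ℤ)).obj V) := ⟨_, hV, ⟨Iso.refl _⟩⟩
  obtain ⟨⟨Y, hY, y, hy⟩, h⟩ := h
  refine ⟨hV'', fun h0 ↦ hy (h0.eq_of_tgt _ _), ?_⟩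
  rintro U ⟨W, hW, ⟨e⟩⟩ f hf Z hZ u v huv
  obtain ⟨W, rfl⟩ := quotient_obj_surjective W
  have hW' := inTleC_iff.1 hW.1
  have hne : fromPObj hW'.1 (𝟙 _) ≫ e.hom ≫ f ≠ 0 := fun h0 ↦ hf
    ((cancel_epi e.hom).1
      ((eq_zero_of_fromPObj_id_comp h𝒞 hW'.1 hW'.2 hV'' _ h0).trans comp_zero.symm))
  obtain ⟨g, hg⟩ := h _ (hW'.2 0) _ hne _ (hV'.2 0) (fromPObj hV'.1 (𝟙 _))
  rw [← sub_eq_zero]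
  refine eq_zero_of_fromPObj_id_comp h𝒞 hV'.1 hV'.2 hZ _ ?_
  rw [← hg]
  simp [huv]

lemma rhoSimple_of_simpleIn (h𝒞 : IsAddKaroubi 𝒞) (happrox : CApproximating 𝒞)
    {V : CochainComplex A ℤ}
    (hV : InHC 𝒞 ((quotient A (ComplexShape.up ℤ)).obj V))
    (h : SimpleIn (EssInHC 𝒞) ((quotient A (ComplexShape.up ℤ)).obj V)) :
    RhoSimple 𝒞 ((quotient A (ComplexShape.up ℤ)).obj V) := by
  have hV' := inTleC_iff.1 hV.1
  obtain ⟨hV'', hne, h⟩ := h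
  refine ⟨⟨V.X 0, hV'.2 0, fromPObj hV'.1 (𝟙 _), fun h0 ↦ hne ?_⟩, ?_⟩
  · rw [IsZero.iff_id_eq_zero]
    exact eq_zero_of_fromPObj_id_comp h𝒞 hV'.1 hV'.2 hV'' _ (by rw [h0, zero_comp])
  intro Y hY y hy Z hZ z
  have hepi := h _ ⟨_, inHC_PObj h𝒞 hY, ⟨Iso.refl _⟩⟩ y hy
  obtain ⟨y, rfl⟩ := fromPObj_surjective hV'.1 y
  obtain ⟨z, rfl⟩ := fromPObj_surjective hV'.1 z
  let w : V.X (-1) ⊞ Y ⟶ V.X 0 := biprod.desc (V.d (-1) 0) y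
  have hK : ∀ i > 0, IsZero ((kernelComplex w).X i) := fun i hi ↦
    isZero_kernelComplex_X w (Or.inl hi)
  obtain ⟨t, ht⟩ := exists_hom_kernelComplex w (V := V) biprod.inl (𝟙 _) (by simp [w])
  have hker : ∀ {Z : A} (g : Z ⟶ V.X 0),
      fromPObj hV'.1 g ≫ (quotient A (ComplexShape.up ℤ)).map t = 0 ↔
        ∃ s : Z ⟶ V.X (-1) ⊞ Y, s ≫ w = g := fun g ↦ by
    rw [fromPObj_comp_quotient_map _ hK, fromPObj_eq_zero_iff, ht]
    exact ⟨fun ⟨s, hs⟩ ↦ ⟨s, hs.trans (Category.comp_id _)⟩,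
      fun ⟨s, hs⟩ ↦ ⟨s, Eq.trans hs (Category.comp_id _).symm⟩⟩
  obtain ⟨T, t', c, hT, htc, hc⟩ := exists_inHC_approximation h𝒞 happrox w hV'.1 hV'.2 t
  have hyt : fromPObj hV'.1 y ≫ (quotient A (ComplexShape.up ℤ)).map t' = 0 := by
    rw [fromPObj_comp_quotient_map _ (inTleC_iff.1 hT.1).1]
    refine hc _ (fun i hi ↦ isZero_single_obj_X _ _ _ _ (by omega)) (single_X_mem h𝒞 hY 0) _ ?_
    change fromPObj (inTleC_iff.1 hT.1).1 _ ≫ c = 0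
    rw [← fromPObj_comp_quotient_map hV'.1, Category.assoc, htc, hker]
    exact ⟨biprod.inr, biprod.inr_desc _ _⟩
  have ht' : (quotient A (ComplexShape.up ℤ)).map t' = 0 :=
    hepi _ ⟨_, hT, ⟨Iso.refl _⟩⟩ _ _ (hyt.trans comp_zero.symm)
  obtain ⟨s, rfl⟩ := (hker z).1 (by rw [← htc, ht', zero_comp, comp_zero])
  refine ⟨s ≫ biprod.snd, ?_⟩
  rw [PMap_comp_fromPObj, eq_comm, fromPObj_eq_iff]
  refine ⟨s ≫ biprod.fst, ?_⟩
  simp [w, biprod.desc_eq]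

end Heart

end HomotopyCategory

/-- In a Krull–Schmidt category an indecomposable object has a local endomorphism ring. -/
lemma KrullSchmidt.isIso_or_isIso_id_sub (hA : KrullSchmidt A) {X : A} (hX : ¬ IsZero X)
    (hX' : ∀ e : X ⟶ X, e ≫ e = e → e = 0 ∨ e = 𝟙 X) (a : X ⟶ X) :
    IsIso a ∨ IsIso (𝟙 X - a) := by
  obtain ⟨n, Z, hZ, ⟨φ⟩⟩ := hA X
  have : HasFiniteBiproducts A := HasFiniteBiproducts.of_hasFiniteProducts
  obtain ⟨k, hk⟩ : ∃ k, φ.hom ≫ biproduct.π Z k ≫ biproduct.ι Z k ≫ φ.inv ≠ 0 := by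
    by_contra! h
    refine hX ((IsZero.iff_id_eq_zero X).2 ?_)
    rw [← cancel_mono φ.hom, ← cancel_epi φ.inv]
    have h' : ∀ k, biproduct.π Z k ≫ biproduct.ι Z k = 0 := fun k ↦ by
      rw [← cancel_mono φ.inv, ← cancel_epi φ.hom, Category.assoc, h k, zero_comp, comp_zero]
    simp [← biproduct.total, h']
  obtain ⟨ψ⟩ : Nonempty (X ≅ Z k) :=
    ⟨{  hom := φ.hom ≫ biproduct.π Z k
        inv := biproduct.ι Z k ≫ φ.inv
        hom_inv_id := by simpa using (hX' _ (by simp)).resolve_left hk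
        inv_hom_id := by simp }⟩
  have := hZ k
  have hconj : ∀ b : X ⟶ X, IsUnit (show End (Z k) from ψ.inv ≫ b ≫ ψ.hom) → IsIso b := by
    intro b hb
    have : IsIso (ψ.inv ≫ b ≫ ψ.hom) := (isUnit_iff_isIso _).1 hb
    have hb' : b = ψ.hom ≫ (ψ.inv ≫ b ≫ ψ.hom) ≫ ψ.inv := by simp
    rw [hb']
    infer_instance
  refine (IsLocalRing.isUnit_or_isUnit_of_add_one
    (a := show End (Z k) from ψ.inv ≫ a ≫ ψ.hom)
    (b := show End (Z k) from ψ.inv ≫ (𝟙 X - a) ≫ ψ.hom) ?_).imp (hconj a) (hconj _)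
  change ψ.inv ≫ a ≫ ψ.hom + ψ.inv ≫ (𝟙 X - a) ≫ ψ.hom = 𝟙 (Z k)
  simp [Preadditive.comp_sub, Preadditive.sub_comp]

namespace HomotopyCategory

open HomologicalComplex

variable {𝒞 : Set A} {L : CochainComplex A ℤ}

lemma not_isSplitEpi_comp_d (h𝒞 : IsAddKaroubi 𝒞)
    (hL : InHC 𝒞 ((quotient A (ComplexShape.up ℤ)).obj L))
    (hL' : ¬ IsZero ((quotient A (ComplexShape.up ℤ)).obj L)) {Y : A} (g : Y ⟶ L.X (-1)) :
    ¬ IsSplitEpi (g ≫ L.d (-1) 0) := by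
  rintro ⟨⟨s, hs⟩⟩
  have h := inTleC_iff.1 hL.1
  refine hL' ((IsZero.iff_id_eq_zero _).2
    (eq_zero_of_fromPObj_id_comp h𝒞 h.1 h.2 ⟨_, hL, ⟨Iso.refl _⟩⟩ _ ?_))
  rw [Category.comp_id]
  exact (fromPObj_eq_zero_iff h.1 _).2 ⟨s ≫ g, by simpa using hs⟩

lemma exists_comp_d_eq_of_comp_d_eq_zero (h𝒞 : IsAddKaroubi 𝒞)
    (hL : InHC 𝒞 ((quotient A (ComplexShape.up ℤ)).obj L)) {Y : A} (hY : Y ∈ 𝒞) {i : ℤ}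
    (hi : i ≤ -1) (g : Y ⟶ L.X i) (hg : g ≫ L.d i (i + 1) = 0) :
    ∃ h : Y ⟶ L.X (i - 1), h ≫ L.d (i - 1) i = g :=
  (quotient_map_mkHomFromSingle_eq_zero_iff g (by rintro k rfl; exact hg) (by simp)).1
    (quotient_map_eq_zero_of_forall_shift hL.2.2 (single_X_mem h𝒞 hY i)
      (fun j hj ↦ isZero_single_obj_X _ _ _ _ (by omega)) _)

lemma exists_comp_d_eq_of_not_isSplitEpi (h𝒞 : IsAddKaroubi 𝒞) (hA : KrullSchmidt A)
    (hL : InHC 𝒞 ((quotient A (ComplexShape.up ℤ)).obj L))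
    (hL' : ¬ IsZero ((quotient A (ComplexShape.up ℤ)).obj L))
    (hρ : RhoSimple 𝒞 ((quotient A (ComplexShape.up ℤ)).obj L)) (h0 : ¬ IsZero (L.X 0))
    (hidem : ∀ e : L.X 0 ⟶ L.X 0, e ≫ e = e → e = 0 ∨ e = 𝟙 (L.X 0)) {Y : A} (hY : Y ∈ 𝒞)
    (f : Y ⟶ L.X 0) (hf : ¬ IsSplitEpi f) :
    ∃ g : Y ⟶ L.X (-1), g ≫ L.d (-1) 0 = f := by
  have h := inTleC_iff.1 hL.1
  by_cases hzero : fromPObj h.1 f = 0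
  · exact (fromPObj_eq_zero_iff h.1 f).1 hzero
  · obtain ⟨g, hg⟩ := hρ.2 Y hY _ hzero _ (h.2 0) (fromPObj h.1 (𝟙 _))
    rw [PMap_comp_fromPObj, eq_comm, fromPObj_eq_iff] at hg
    obtain ⟨s, hs⟩ := hg
    obtain hiso | hiso := hA.isIso_or_isIso_id_sub h0 hidem (g ≫ f)
    · exact (hf ⟨⟨inv (g ≫ f) ≫ g, by simp⟩⟩).elim
    · rw [← hs] at hiso
      exact (not_isSplitEpi_comp_d h𝒞 hL hL' s inferInstance).elim

end HomotopyCategory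

/-!
STATEMENT 10: Assume `C` is `A`-approximating.  For `V = [⋯ → C⁻¹ → C⁰] ∈ H_C`, `V` is
simple in `H_C` iff `ρ_C V` is simple in `Mod C`.  Moreover if `A` is Krull–Schmidt,
`X ∈ C` is indecomposable and `L_X = [⋯ → C⁻ⁿ → ⋯ → C⁻¹ → X]` is a simple quotient of
`P_X` in `H_C`, then `ρ_C L_X ≅ Hom_C(−, X)/J(−, X)`, i.e. the sequence
`⋯ → Hom_C(−, C⁻ⁿ) → ⋯ → Hom_C(−, C⁻¹) → J(−, X) → 0` is exact, where
`J(Y, X) = {f : Y ⟶ X | f is not a split epimorphism}`.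
-/
theorem statement10 {A : Type u} [Category.{v} A] [Abelian A]
    (𝒞 : Set A) (h𝒞 : IsAddKaroubi 𝒞) (happrox : CApproximating 𝒞) :
    -- (i) simplicity is detected by the Yoneda embedding `ρ_C`:
    (∀ V, InHC 𝒞 V → (SimpleIn (EssInHC 𝒞) V ↔ RhoSimple 𝒞 V))
    -- (ii) the simple quotient `L_X` of `P_X` gives a projective resolution of `J(−, X)`:
    ∧ (KrullSchmidt A →
        ∀ L, InHC 𝒞 L →
          -- `X := L.as.X 0` is indecomposable:
          (¬ IsZero (L.as.X 0)) →
          (∀ e : L.as.X 0 ⟶ L.as.X 0, e ≫ e = e → e = 0 ∨ e = 𝟙 (L.as.X 0)) →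
          -- `L` is a simple quotient of `P_X` in `H_C`:
          SimpleIn (EssInHC 𝒞) L →
          (∃ q : PObj (L.as.X 0) ⟶ L, EpiIn (EssInHC 𝒞) q) →
          ∀ Y ∈ 𝒞,
            -- the image of `Hom(Y, C⁻¹) → Hom(Y, X)` is contained in `J(Y, X)` …
            (∀ g : Y ⟶ L.as.X (-1), ¬ IsSplitEpi (g ≫ L.as.d (-1) 0)) ∧
            -- … and equals `J(Y, X)`:
            (∀ f : Y ⟶ L.as.X 0, ¬ IsSplitEpi f →
              ∃ g : Y ⟶ L.as.X (-1), g ≫ L.as.d (-1) 0 = f) ∧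
            -- exactness of `(*)` at `Hom(−, C⁻ⁿ)` for all `n ≥ 1`:
            (∀ i : ℤ, i ≤ -1 → ∀ g : Y ⟶ L.as.X i, g ≫ L.as.d i (i + 1) = 0 →
              ∃ h : Y ⟶ L.as.X (i - 1), h ≫ L.as.d (i - 1) i = g)) := by
  have hiff : ∀ V, InHC 𝒞 V → (SimpleIn (EssInHC 𝒞) V ↔ RhoSimple 𝒞 V) := fun V hV ↦ by
    obtain ⟨V, rfl⟩ := HomotopyCategory.quotient_obj_surjective V
    exact ⟨HomotopyCategory.rhoSimple_of_simpleIn h𝒞 happrox hV,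
      HomotopyCategory.simpleIn_of_rhoSimple h𝒞 hV⟩
  refine ⟨hiff, fun hA L hL h0 hidem hsimple _ Y hY ↦ ?_⟩
  have hρ := (hiff L hL).1 hsimple
  obtain ⟨L, rfl⟩ := HomotopyCategory.quotient_obj_surjective L
  exact ⟨HomotopyCategory.not_isSplitEpi_comp_d h𝒞 hL hsimple.2.1,
    HomotopyCategory.exists_comp_d_eq_of_not_isSplitEpi h𝒞 hA hL hsimple.2.1 hρ h0 hidem hY,
    fun _ hi ↦ HomotopyCategory.exists_comp_d_eq_of_comp_d_eq_zero h𝒞 hL hY hi⟩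
end
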